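/- arXiv:2310.17615 — 10 statements merged into one kernel-verified Lean document; each statement's English description precedes it below -/
import Mathlib

section
/- For every finite set S of integers with each element ≥ 2, there exists a locally integrable function f : ℝ → ℝ such that for every n ∈ S the supremum over all n-adic intervals I of the mean oscillation ⨍_I |f − ⨍_I f| is finite, yet the supremum over all nondegenerate bounded intervals I of ⨍_I |f − ⨍_I f| is infinite. In other words, f lies in BMO_n for every n ∈ S but f does not lie in BMO. -/
open MeasureTheory

/-- The `n`-adic interval `[(k-1)/n^m, k/n^m)`. -/
def adicInterval (n : ℕ) (m k : ℤ) : Set ℝ :=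
  Set.Ico (((k : ℝ) - 1) / (n : ℝ) ^ m) ((k : ℝ) / (n : ℝ) ^ m)

/-- The mean oscillation of `f` over the set `s`, with respect to Lebesgue measure:
`⨍_s |f - ⨍_s f|`. -/
noncomputable def meanOsc (f : ℝ → ℝ) (s : Set ℝ) : ℝ :=
  ⨍ x in s, |f x - ⨍ y in s, f y|

lemma meanOsc_Ico (f : ℝ → ℝ) {a b : ℝ} (h : a < b) :
    meanOsc f (Set.Ico a b) =
      (b - a)⁻¹ * ∫ x in a..b, |f x - (b - a)⁻¹ * ∫ y in a..b, f y| := by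
  simp only [meanOsc, setAverage_eq, smul_eq_mul, Real.volume_real_Ico_of_le h.le,
    integral_Ico_eq_integral_Ioc, intervalIntegral.integral_of_le h.le]

/-- The logarithm on the positive half-line, extended by zero. -/
noncomputable def halfLineLog (x : ℝ) : ℝ := (Set.Ioi (0 : ℝ)).indicator Real.log x

lemma halfLineLog_of_nonneg {x : ℝ} (h : 0 ≤ x) : halfLineLog x = Real.log x := by
  rcases h.eq_or_lt with rfl | h
  · simp [halfLineLog]
  · exact Set.indicator_of_mem (Set.mem_Ioi.2 h) _

lemma halfLineLog_of_nonpos {x : ℝ} (h : x ≤ 0) : halfLineLog x = 0 :=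
  Set.indicator_of_notMem (by simpa using h) _

lemma locallyIntegrable_halfLineLog : LocallyIntegrable halfLineLog volume := by
  have h : LocallyIntegrable Real.log volume := by
    intro x
    refine ⟨Set.Ioc (x - 1) (x + 1), Ioc_mem_nhds (by linarith) (by linarith), ?_⟩
    exact (intervalIntegrable_iff_integrableOn_Ioc_of_le (by linarith)).1
      intervalIntegral.intervalIntegrable_log'
  exact h.indicator measurableSet_Ioi

lemma intervalIntegrable_halfLineLog (a b : ℝ) : IntervalIntegrable halfLineLog volume a b :=
  (locallyIntegrable_halfLineLog.integrableOn_isCompact isCompact_uIcc).intervalIntegrable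

lemma integral_halfLineLog_of_nonneg {a b : ℝ} (ha : 0 ≤ a) (hb : 0 ≤ b) :
    ∫ x in a..b, halfLineLog x = b * Real.log b - a * Real.log a - b + a := by
  rw [← integral_log]
  refine intervalIntegral.integral_congr fun x hx => halfLineLog_of_nonneg ?_
  exact (le_inf ha hb).trans hx.1

lemma integral_halfLineLog_of_nonpos {a b : ℝ} (ha : a ≤ 0) (hb : b ≤ 0) :
    ∫ x in a..b, halfLineLog x = 0 := by
  rw [← intervalIntegral.integral_zero (μ := volume) (a := a) (b := b)]
  refine intervalIntegral.integral_congr fun x hx => halfLineLog_of_nonpos ?_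
  exact hx.2.trans (sup_le ha hb)

lemma meanOsc_halfLineLog_of_nonpos {a b : ℝ} (h : a < b) (hb : b ≤ 0) :
    meanOsc halfLineLog (Set.Ico a b) = 0 := by
  rw [meanOsc_Ico _ h, integral_halfLineLog_of_nonpos (h.le.trans hb) hb]
  rw [intervalIntegral.integral_congr (g := fun _ => 0), intervalIntegral.integral_zero, mul_zero]
  intro x hx
  simp [halfLineLog_of_nonpos (hx.2.trans (sup_le (h.le.trans hb) hb))]

lemma meanOsc_halfLineLog_le {a b : ℝ} (ha : 0 ≤ a) (h : a < b) :
    meanOsc halfLineLog (Set.Ico a b) ≤ 2 := by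
  have hb : 0 < b := ha.trans_lt h
  have hba : 0 < b - a := sub_pos.2 h
  rw [meanOsc_Ico _ h]
  set c := (b - a)⁻¹ * ∫ y in a..b, halfLineLog y with hc
  have hI := integral_halfLineLog_of_nonneg ha hb.le
  have hlog : a * Real.log a ≤ a * Real.log b := by
    rcases ha.eq_or_lt with rfl | ha'
    · simp
    · exact mul_le_mul_of_nonneg_left (Real.log_le_log ha' h.le) ha
  have hc' : (b - a) * c = ∫ y in a..b, halfLineLog y := by rw [hc]; field_simp
  have hle : ∀ x ∈ Set.Icc a b, a < x → halfLineLog x ≤ Real.log b := fun x hx hax => by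
    rw [halfLineLog_of_nonneg (ha.trans hx.1)]
    exact Real.log_le_log (ha.trans_lt hax) hx.2
  have hint := intervalIntegrable_halfLineLog a b
  have hcb : c ≤ Real.log b := by
    have h1 : ∫ y in a..b, halfLineLog y ≤ ∫ _ in a..b, Real.log b := by
      refine intervalIntegral.integral_mono_on_of_le_Ioo h.le hint (by simp) fun x hx => ?_
      exact hle x (Set.Ioo_subset_Icc_self hx) hx.1
    rw [← hc', intervalIntegral.integral_const, smul_eq_mul] at h1
    exact le_of_mul_le_mul_left h1 hba
  have hmono : ∫ x in a..b, |halfLineLog x - c| ≤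
      ∫ x in a..b, ((Real.log b - halfLineLog x) + (Real.log b - c)) := by
    refine intervalIntegral.integral_mono_on_of_le_Ioo h.le (hint.sub (by simp)).abs
      (((by simp : IntervalIntegrable (fun _ => Real.log b) volume a b).sub hint).add (by simp))
      fun x hx => ?_
    have := hle x (Set.Ioo_subset_Icc_self hx) hx.1
    rw [abs_le]
    constructor <;> linarith
  have heq : ∫ x in a..b, ((Real.log b - halfLineLog x) + (Real.log b - c)) =
      2 * ((b - a) * Real.log b - ∫ x in a..b, halfLineLog x) := by
    rw [intervalIntegral.integral_add ((by simp : IntervalIntegrable (fun _ => Real.log b)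
      volume a b).sub hint) (by simp), intervalIntegral.integral_sub (by simp) hint,
      intervalIntegral.integral_const, intervalIntegral.integral_const, smul_eq_mul, smul_eq_mul]
    linear_combination -hc'
  rw [inv_mul_le_iff₀ hba]
  nlinarith

lemma le_meanOsc_halfLineLog (t : ℝ) :
    (t - 1) / 4 ≤ meanOsc halfLineLog (Set.Ico (-Real.exp t) (Real.exp t)) := by
  have he := Real.exp_pos t
  have hne : -Real.exp t < Real.exp t := by linarith
  have hI : ∫ x in -Real.exp t..Real.exp t, halfLineLog x = Real.exp t * (t - 1) := by
    rw [← intervalIntegral.integral_add_adjacent_intervals (intervalIntegrable_halfLineLog _ 0)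
      (intervalIntegrable_halfLineLog 0 _), integral_halfLineLog_of_nonpos (by linarith) le_rfl,
      integral_halfLineLog_of_nonneg le_rfl he.le, Real.log_exp]
    ring
  have hc : (Real.exp t - -Real.exp t)⁻¹ * (Real.exp t * (t - 1)) = (t - 1) / 2 := by
    field_simp
    ring
  rw [meanOsc_Ico _ hne, hI, hc]
  have habs (a b : ℝ) : IntervalIntegrable (fun x => |halfLineLog x - (t - 1) / 2|) volume a b :=
    ((intervalIntegrable_halfLineLog a b).sub (by simp)).abs
  rw [← intervalIntegral.integral_add_adjacent_intervals (habs _ 0) (habs 0 _)]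
  have hleft : ∫ x in -Real.exp t..0, |halfLineLog x - (t - 1) / 2| =
      Real.exp t * |(t - 1) / 2| := by
    rw [intervalIntegral.integral_congr (g := fun _ => |(t - 1) / 2|)]
    · simp
    · intro x hx
      simp only [halfLineLog_of_nonpos (hx.2.trans (sup_le (by linarith) le_rfl)), zero_sub,
        abs_neg]
  have hright : 0 ≤ ∫ x in 0..Real.exp t, |halfLineLog x - (t - 1) / 2| :=
    intervalIntegral.integral_nonneg he.le fun _ _ => abs_nonneg _
  rw [hleft, le_inv_mul_iff₀ (by linarith)]
  nlinarith [le_abs_self ((t - 1) / 2)]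

/-- For every finite set `S` of integers `≥ 2`, there is a locally integrable function
`f : ℝ → ℝ` whose mean oscillation is uniformly bounded over `n`-adic intervals for every
`n ∈ S`, but whose mean oscillation over all nondegenerate bounded intervals is unbounded:
`f ∈ BMO_n` for all `n ∈ S` but `f ∉ BMO`. -/
theorem bmo_intersection_ne_bmo (S : Finset ℕ) (hS : ∀ n ∈ S, 2 ≤ n) :
    ∃ f : ℝ → ℝ, LocallyIntegrable f volume ∧
      (∀ n ∈ S, ∃ M : ℝ, ∀ m k : ℤ, meanOsc f (adicInterval n m k) ≤ M) ∧
      ¬ ∃ M : ℝ, ∀ a b : ℝ, a < b → meanOsc f (Set.Ico a b) ≤ M := by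
  refine ⟨halfLineLog, locallyIntegrable_halfLineLog, fun n hn => ⟨2, fun m k => ?_⟩, ?_⟩
  · have hn0 : (0 : ℝ) < n := by
      have := hS n hn
      exact_mod_cast (by omega : 0 < n)
    have hp : (0 : ℝ) < (n : ℝ) ^ m := zpow_pos hn0 m
    have hlt : ((k : ℝ) - 1) / (n : ℝ) ^ m < (k : ℝ) / (n : ℝ) ^ m :=
      div_lt_div_of_pos_right (by linarith) hp
    rcases le_or_gt k 0 with hk | hk
    · have hk' : (k : ℝ) ≤ 0 := by exact_mod_cast hk
      rw [adicInterval, meanOsc_halfLineLog_of_nonpos hlt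
        (div_nonpos_of_nonpos_of_nonneg hk' hp.le)]
      norm_num
    · have hk' : (1 : ℝ) ≤ k := by exact_mod_cast hk
      exact meanOsc_halfLineLog_le (div_nonneg (by linarith) hp.le) hlt
  · rintro ⟨M, hM⟩
    have h1 := le_meanOsc_halfLineLog (4 * M + 5)
    have he := Real.exp_pos (4 * M + 5)
    have h2 := hM (-Real.exp (4 * M + 5)) (Real.exp (4 * M + 5)) (by linarith)
    linarith
end

section
/- For every r with 1 < r < ∞ and every finite set S of integers with each element ≥ 2, there exists a nonnegative locally integrable function w : ℝ → ℝ with positive integral over every nondegenerate bounded interval, such that: for every n ∈ S there is a constant C_n with (⨍_P w^r)^{1/r} ≤ C_n · ⨍_P w for every n-adic interval P, yet there is no constant C with (⨍_I w^r)^{1/r} ≤ C · ⨍_I w for every nondegenerate bounded interval I. In other words, w lies in the n-adic reverse Hölder class RH_r^n for every n ∈ S but not in the reverse Hölder class RH_r. -/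
open MeasureTheory

/-- The weight equal to `1` on `[0, ∞)` and to `|x|` on `(-∞, 0)`. -/
noncomputable def jumpWeight (x : ℝ) : ℝ := if 0 ≤ x then 1 else -x

lemma jumpWeight_of_nonneg {x : ℝ} (hx : 0 ≤ x) : jumpWeight x = 1 := if_pos hx

lemma jumpWeight_of_neg {x : ℝ} (hx : x < 0) : jumpWeight x = -x := if_neg hx.not_ge

lemma jumpWeight_pos (x : ℝ) : 0 < jumpWeight x := by
  unfold jumpWeight
  split_ifs <;> linarith

lemma jumpWeight_le (x : ℝ) : jumpWeight x ≤ 1 + |x| := by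
  unfold jumpWeight
  split_ifs
  · linarith [abs_nonneg x]
  · linarith [neg_le_abs x]

lemma measurable_jumpWeight : Measurable jumpWeight :=
  Measurable.ite measurableSet_Ici measurable_const measurable_neg

lemma locallyIntegrable_jumpWeight_rpow {r : ℝ} (hr : 0 ≤ r) :
    LocallyIntegrable (fun x => jumpWeight x ^ r) volume := by
  have hc : Continuous fun x : ℝ => (1 + |x|) ^ r :=
    Continuous.rpow_const (by fun_prop) fun _ => Or.inr hr
  refine hc.locallyIntegrable.mono (measurable_jumpWeight.pow_const r).aestronglyMeasurable
    (.of_forall fun x => ?_)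
  have h0 := (jumpWeight_pos x).le
  rw [Real.norm_of_nonneg (by positivity), Real.norm_of_nonneg (by positivity)]
  exact Real.rpow_le_rpow h0 (jumpWeight_le x) hr

lemma locallyIntegrable_jumpWeight : LocallyIntegrable jumpWeight volume := by
  simpa using locallyIntegrable_jumpWeight_rpow zero_le_one

lemma integrableOn_Ico_of_locallyIntegrable {f : ℝ → ℝ} (hf : LocallyIntegrable f volume)
    (a b : ℝ) : IntegrableOn f (Set.Ico a b) volume :=
  (hf.integrableOn_isCompact isCompact_Icc).mono_set Set.Ico_subset_Icc_self

lemma setAverage_Ico {a b : ℝ} (hab : a < b) (f : ℝ → ℝ) :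
    ⨍ x in Set.Ico a b, f x = (∫ x in Set.Ico a b, f x) / (b - a) := by
  rw [setAverage_eq, Real.volume_real_Ico_of_le hab.le, smul_eq_mul, inv_mul_eq_div]

lemma setIntegral_Ico_jumpWeight_of_nonneg {a b : ℝ} (hab : a ≤ b) (ha : 0 ≤ a) :
    ∫ x in Set.Ico a b, jumpWeight x = b - a := by
  rw [setIntegral_congr_fun measurableSet_Ico
    fun x hx => jumpWeight_of_nonneg (ha.trans hx.1)]
  simp [hab]

lemma setIntegral_Ico_jumpWeight_of_nonpos {a b : ℝ} (hab : a ≤ b) (hb : b ≤ 0) :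
    ∫ x in Set.Ico a b, jumpWeight x = (a ^ 2 - b ^ 2) / 2 := by
  rw [setIntegral_congr_fun measurableSet_Ico
    fun x hx => jumpWeight_of_neg (hx.2.trans_le hb), integral_Ico_eq_integral_Ioc,
    ← intervalIntegral.integral_of_le hab, intervalIntegral.integral_neg, integral_id]
  ring

lemma setAverage_rpow_rpow_le {r a b M : ℝ} (hr : 0 < r) (hab : a < b)
    (hM : ∀ x ∈ Set.Ico a b, jumpWeight x ≤ M) :
    (⨍ x in Set.Ico a b, jumpWeight x ^ r) ^ (1 / r) ≤ M := by
  have hM0 : 0 ≤ M := (jumpWeight_pos a).le.trans (hM a ⟨le_rfl, hab⟩)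
  have hle : ⨍ x in Set.Ico a b, jumpWeight x ^ r ≤ M ^ r := by
    rw [setAverage_Ico hab, div_le_iff₀ (sub_pos.2 hab)]
    calc ∫ x in Set.Ico a b, jumpWeight x ^ r
        ≤ ∫ _ in Set.Ico a b, M ^ r :=
          setIntegral_mono_on
            (integrableOn_Ico_of_locallyIntegrable (locallyIntegrable_jumpWeight_rpow hr.le) a b)
            (integrableOn_const (by simp)) measurableSet_Ico
            fun x hx => Real.rpow_le_rpow (jumpWeight_pos x).le (hM x hx) hr.le
      _ = M ^ r * (b - a) := by simp [hab.le, mul_comm]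
  have h0 : 0 ≤ ⨍ x in Set.Ico a b, jumpWeight x ^ r := by
    rw [setAverage_Ico hab]
    exact div_nonneg (integral_nonneg fun x => Real.rpow_nonneg (jumpWeight_pos x).le r)
      (sub_pos.2 hab).le
  calc (⨍ x in Set.Ico a b, jumpWeight x ^ r) ^ (1 / r)
      ≤ (M ^ r) ^ (1 / r) := Real.rpow_le_rpow h0 hle (by positivity)
    _ = M := by rw [← Real.rpow_mul hM0, mul_one_div_cancel hr.ne', Real.rpow_one]

/-- `jumpWeight` satisfies a reverse Hölder inequality on intervals not having `0` inside. -/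
lemma jumpWeight_reverse_holder {r a b : ℝ} (hr : 0 < r) (hab : a < b) (h : 0 ≤ a ∨ b ≤ 0) :
    (⨍ x in Set.Ico a b, jumpWeight x ^ r) ^ (1 / r) ≤
      2 * ⨍ x in Set.Ico a b, jumpWeight x := by
  have hab' := sub_pos.2 hab
  rcases h with ha | hb
  · refine (setAverage_rpow_rpow_le hr hab
      fun x hx => (jumpWeight_of_nonneg (ha.trans hx.1)).le).trans ?_
    rw [setAverage_Ico hab, setIntegral_Ico_jumpWeight_of_nonneg hab.le ha, div_self hab'.ne']
    norm_num
  · refine (setAverage_rpow_rpow_le (M := -a) hr hab fun x hx => ?_).trans ?_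
    · rw [jumpWeight_of_neg (hx.2.trans_le hb)]
      exact neg_le_neg hx.1
    · rw [setAverage_Ico hab, setIntegral_Ico_jumpWeight_of_nonpos hab.le hb, ← mul_div_assoc,
        le_div_iff₀ hab']
      nlinarith

lemma setIntegral_jumpWeight_pos {a b : ℝ} (hab : a < b) :
    0 < ∫ x in Set.Ico a b, jumpWeight x := by
  rw [setIntegral_pos_iff_support_of_nonneg_ae (.of_forall fun x => (jumpWeight_pos x).le)
    (integrableOn_Ico_of_locallyIntegrable locallyIntegrable_jumpWeight a b),
    Function.support_eq_univ fun x => (jumpWeight_pos x).ne', Set.univ_inter]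
  simpa using hab

lemma setAverage_jumpWeight_le {t : ℝ} (ht : 0 < t) :
    ⨍ x in Set.Ico (-t) (t ^ 2), jumpWeight x ≤ 3 / 2 * t := by
  have hlt : -t < t ^ 2 := by nlinarith
  have hI := integrableOn_Ico_of_locallyIntegrable locallyIntegrable_jumpWeight
  rw [setAverage_Ico hlt, div_le_iff₀ (sub_pos.2 hlt),
    ← Set.Ico_union_Ico_eq_Ico (neg_nonpos.2 ht.le) (sq_nonneg t),
    setIntegral_union (Set.Ico_disjoint_Ico_same) measurableSet_Ico (hI _ _) (hI _ _),
    setIntegral_Ico_jumpWeight_of_nonpos (neg_nonpos.2 ht.le) le_rfl,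
    setIntegral_Ico_jumpWeight_of_nonneg (sq_nonneg t) le_rfl]
  nlinarith [pow_pos ht 3]

lemma le_setAverage_jumpWeight_rpow {r t : ℝ} (hr : 0 ≤ r) (ht : 0 < t) (ht1 : t ≤ 1) :
    t / 2 ≤ ⨍ x in Set.Ico (-t) (t ^ 2), jumpWeight x ^ r := by
  have hlt : -t < t ^ 2 := by nlinarith
  have hsub : t ^ 2 ≤ ∫ x in Set.Ico (-t) (t ^ 2), jumpWeight x ^ r :=
    calc t ^ 2 = ∫ x in Set.Ico 0 (t ^ 2), jumpWeight x ^ r := by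
          rw [setIntegral_congr_fun (g := fun _ => (1 : ℝ)) measurableSet_Ico
            fun x hx => by simp [jumpWeight_of_nonneg hx.1]]
          simp [sq_nonneg t]
      _ ≤ _ := setIntegral_mono_set
          (integrableOn_Ico_of_locallyIntegrable (locallyIntegrable_jumpWeight_rpow hr) _ _)
          (.of_forall fun x => Real.rpow_nonneg (jumpWeight_pos x).le r)
          (Set.Ico_subset_Ico_left (neg_nonpos.2 ht.le)).eventuallyLE
  rw [setAverage_Ico hlt, le_div_iff₀ (sub_pos.2 hlt)]
  nlinarith [sq_nonneg t]

lemma not_jumpWeight_reverse_holder {r : ℝ} (hr : 1 < r) :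
    ¬ ∃ C : ℝ, ∀ a b : ℝ, a < b →
      (⨍ x in Set.Ico a b, jumpWeight x ^ r) ^ (1 / r) ≤
        C * ⨍ x in Set.Ico a b, jumpWeight x := by
  rintro ⟨C, hC⟩
  have hr0 : 0 < r := one_pos.trans hr
  have hs : 0 < 1 - 1 / r := by
    rw [sub_pos, div_lt_one hr0]
    exact hr
  have key : ∀ t : ℝ, 0 < t → t ≤ 1 → 1 ≤ 3 * |C| * (t / 2) ^ (1 - 1 / r) := by
    intro t ht ht1
    have hlt : -t < t ^ 2 := by nlinarith
    have h2 : 0 < t / 2 := half_pos ht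
    have hA : 0 ≤ ⨍ x in Set.Ico (-t) (t ^ 2), jumpWeight x := by
      rw [setAverage_Ico hlt]
      exact div_nonneg (setIntegral_jumpWeight_pos hlt).le (sub_pos.2 hlt).le
    have h : (t / 2) ^ (1 / r) ≤ 3 * |C| * (t / 2) :=
      calc (t / 2) ^ (1 / r)
          ≤ (⨍ x in Set.Ico (-t) (t ^ 2), jumpWeight x ^ r) ^ (1 / r) :=
            Real.rpow_le_rpow h2.le (le_setAverage_jumpWeight_rpow hr0.le ht ht1) (by positivity)
        _ ≤ C * ⨍ x in Set.Ico (-t) (t ^ 2), jumpWeight x := hC _ _ hlt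
        _ ≤ |C| * (3 / 2 * t) :=
            mul_le_mul (le_abs_self C) (setAverage_jumpWeight_le ht) hA (abs_nonneg C)
        _ = 3 * |C| * (t / 2) := by ring
    rwa [Real.rpow_sub h2, Real.rpow_one, ← mul_div_assoc, one_le_div (Real.rpow_pos_of_pos h2 _)]
  have hcont : Continuous fun t : ℝ => 3 * |C| * (t / 2) ^ (1 - 1 / r) :=
    continuous_const.mul ((continuous_id.div_const 2).rpow_const fun _ => Or.inr hs.le)
  have hlim := (hcont.tendsto 0).mono_left (nhdsWithin_le_nhds (s := Set.Ioi 0))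
  have hge := ge_of_tendsto hlim <| Filter.mem_of_superset
    (Ioc_mem_nhdsGT (zero_lt_one' ℝ)) fun t ht => key t ht.1 ht.2
  rw [zero_div, Real.zero_rpow hs.ne', mul_zero] at hge
  exact hge.not_gt one_pos

/-- For every `1 < r < ∞` and every finite set `S` of integers `≥ 2`, there exists a
nonnegative locally integrable weight `w` with positive integral over every nondegenerate
bounded interval, which satisfies an `r`-reverse Hölder inequality over all `n`-adic
intervals for each `n ∈ S` (so `w ∈ RH_r^n`), but satisfies no `r`-reverse Hölder
inequality over all nondegenerate bounded intervals (so `w ∉ RH_r`). -/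
theorem reverse_holder_intersection_ne (r : ℝ) (hr : 1 < r)
    (S : Finset ℕ) (hS : ∀ n ∈ S, 2 ≤ n) :
    ∃ w : ℝ → ℝ, (∀ x, 0 ≤ w x) ∧ LocallyIntegrable w volume ∧
      (∀ a b : ℝ, a < b → 0 < ∫ x in Set.Ico a b, w x) ∧
      (∀ n ∈ S, ∃ C : ℝ, ∀ m k : ℤ,
        (⨍ x in adicInterval n m k, (w x) ^ r) ^ (1 / r) ≤
          C * ⨍ x in adicInterval n m k, w x) ∧
      ¬ ∃ C : ℝ, ∀ a b : ℝ, a < b →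
        (⨍ x in Set.Ico a b, (w x) ^ r) ^ (1 / r) ≤ C * ⨍ x in Set.Ico a b, w x := by
  refine ⟨jumpWeight, fun x => (jumpWeight_pos x).le, locallyIntegrable_jumpWeight,
    fun a b => setIntegral_jumpWeight_pos, fun n hn => ⟨2, fun m k => ?_⟩,
    not_jumpWeight_reverse_holder hr⟩
  have hn0 : (0 : ℝ) < n := by exact_mod_cast two_pos.trans_le (hS n hn)
  have hpow : (0 : ℝ) < (n : ℝ) ^ m := zpow_pos hn0 m
  refine jumpWeight_reverse_holder (one_pos.trans hr)
    (div_lt_div_of_pos_right (sub_one_lt _) hpow) ?_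
  rcases lt_or_ge 0 k with hk | hk
  · have hk1 : (1 : ℝ) ≤ k := by exact_mod_cast hk
    exact Or.inl (div_nonneg (sub_nonneg.2 hk1) hpow.le)
  · have hk0 : (k : ℝ) ≤ 0 := by exact_mod_cast hk
    exact Or.inr (div_nonpos_of_nonpos_of_nonneg hk0 hpow.le)
end

section
/- For every r with 1 < r < ∞ and every finite set S of integers with each element ≥ 2, there exists a nonnegative locally integrable function w : ℝ → ℝ, positive almost everywhere and with w^{−1/(r−1)} locally integrable, such that: for every n ∈ S the supremum over all n-adic intervals P of (⨍_P w)·(⨍_P w^{−1/(r−1)})^{r−1} is finite, yet the supremum over all nondegenerate bounded intervals I of (⨍_I w)·(⨍_I w^{−1/(r−1)})^{r−1} is infinite. In other words, w lies in the n-adic Muckenhoupt class A_r^n for every n ∈ S but not in the Muckenhoupt class A_r. -/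
open MeasureTheory

/-- The function equal to `1` on the negative half-line and to `x ^ p` on the nonnegative one. -/
noncomputable def oneSidedPower (p x : ℝ) : ℝ := if x < 0 then 1 else x ^ p

theorem oneSidedPower_nonneg (p x : ℝ) : 0 ≤ oneSidedPower p x := by
  unfold oneSidedPower
  split_ifs with h
  · exact zero_le_one
  · exact Real.rpow_nonneg (not_lt.mp h) p

theorem oneSidedPower_pos (p : ℝ) {x : ℝ} (hx : x ≠ 0) : 0 < oneSidedPower p x := by
  unfold oneSidedPower
  split_ifs with h
  · exact zero_lt_one
  · exact Real.rpow_pos_of_pos (lt_of_le_of_ne (not_lt.mp h) hx.symm) p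

theorem oneSidedPower_rpow (p q x : ℝ) :
    oneSidedPower p x ^ q = oneSidedPower (p * q) x := by
  unfold oneSidedPower
  split_ifs with h
  · exact Real.one_rpow q
  · exact (Real.rpow_mul (not_lt.mp h) p q).symm

theorem locallyIntegrable_rpow {p : ℝ} (hp : -1 < p) :
    LocallyIntegrable (fun x : ℝ => x ^ p) volume := by
  intro x
  refine ⟨Set.Ioc (x - 1) (x + 1), Ioc_mem_nhds (by linarith) (by linarith), ?_⟩
  exact (intervalIntegrable_iff_integrableOn_Ioc_of_le (by linarith)).mp
    (intervalIntegral.intervalIntegrable_rpow' hp)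

theorem locallyIntegrable_oneSidedPower {p : ℝ} (hp : -1 < p) :
    LocallyIntegrable (oneSidedPower p) volume := by
  have h1 : LocallyIntegrable ((Set.Iio (0 : ℝ)).indicator fun _ => (1 : ℝ)) volume :=
    (locallyIntegrable_const 1).indicator measurableSet_Iio
  have h2 := (locallyIntegrable_rpow hp).indicator (measurableSet_Ici (a := (0 : ℝ)))
  refine (h1.add h2).congr (ae_of_all _ fun x => ?_)
  by_cases h : x < 0
  · simp [oneSidedPower, h]
  · simp [oneSidedPower, h, not_lt.mp h]

theorem integrableOn_oneSidedPower {p : ℝ} (hp : -1 < p) (a b : ℝ) :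
    IntegrableOn (oneSidedPower p) (Set.Ico a b) volume :=
  ((locallyIntegrable_oneSidedPower hp).integrableOn_isCompact isCompact_Icc).mono_set
    Set.Ico_subset_Icc_self

theorem setIntegral_oneSidedPower_of_nonpos (p : ℝ) {a b : ℝ} (hab : a ≤ b) (hb : b ≤ 0) :
    ∫ x in Set.Ico a b, oneSidedPower p x = b - a := by
  have h : Set.EqOn (oneSidedPower p) (fun _ => 1) (Set.Ico a b) := fun x hx =>
    if_pos (hx.2.trans_le hb)
  rw [setIntegral_congr_fun measurableSet_Ico h]
  simp [hab]

theorem setIntegral_oneSidedPower_of_nonneg {p : ℝ} (hp : -1 < p) {a b : ℝ} (ha : 0 ≤ a)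
    (hab : a ≤ b) :
    ∫ x in Set.Ico a b, oneSidedPower p x = (b ^ (p + 1) - a ^ (p + 1)) / (p + 1) := by
  have h : Set.EqOn (oneSidedPower p) (fun x => x ^ p) (Set.Ico a b) := fun x hx =>
    if_neg (not_lt.mpr (ha.trans hx.1))
  rw [setIntegral_congr_fun measurableSet_Ico h, integral_Ico_eq_integral_Ioc,
    ← intervalIntegral.integral_of_le hab, integral_rpow (Or.inl hp)]

theorem setAverage_Ico_eq_div (f : ℝ → ℝ) {a b : ℝ} (hab : a ≤ b) :
    ⨍ x in Set.Ico a b, f x = (∫ x in Set.Ico a b, f x) / (b - a) := by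
  rw [setAverage_eq, Real.volume_real_Ico_of_le hab, smul_eq_mul, inv_mul_eq_div]

theorem setAverage_oneSidedPower_of_nonpos (p : ℝ) {a b : ℝ} (hab : a < b) (hb : b ≤ 0) :
    ⨍ x in Set.Ico a b, oneSidedPower p x = 1 := by
  rw [setAverage_Ico_eq_div _ hab.le, setIntegral_oneSidedPower_of_nonpos p hab.le hb,
    div_self (sub_pos.mpr hab).ne']

theorem setAverage_oneSidedPower_nonneg (p a b : ℝ) :
    0 ≤ ⨍ x in Set.Ico a b, oneSidedPower p x :=
  integral_nonneg (oneSidedPower_nonneg p)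

theorem setAverage_oneSidedPower_le {p : ℝ} (hp : 0 ≤ p) {a b : ℝ} (ha : 0 ≤ a) (hab : a < b) :
    ⨍ x in Set.Ico a b, oneSidedPower p x ≤ b ^ p := by
  rw [setAverage_Ico_eq_div _ hab.le, div_le_iff₀ (sub_pos.mpr hab)]
  calc ∫ x in Set.Ico a b, oneSidedPower p x ≤ ∫ _ in Set.Ico a b, b ^ p := by
        refine setIntegral_mono_on (integrableOn_oneSidedPower (by linarith) a b)
          (integrableOn_const (by simp)) measurableSet_Ico fun x hx => ?_
        rw [oneSidedPower, if_neg (not_lt.mpr (ha.trans hx.1))]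
        exact Real.rpow_le_rpow (ha.trans hx.1) hx.2.le hp
    _ = b ^ p * (b - a) := by
        rw [setIntegral_const, Real.volume_real_Ico_of_le hab.le, smul_eq_mul, mul_comm]

theorem setAverage_oneSidedPower_neg_half_le {a b : ℝ} (ha : 0 ≤ a) (hab : a < b) :
    ⨍ x in Set.Ico a b, oneSidedPower (-1 / 2) x ≤ 2 / √b := by
  have hb : 0 < √b := Real.sqrt_pos.mpr (ha.trans_lt hab)
  have hs : √a ≤ √b := Real.sqrt_le_sqrt hab.le
  rw [setAverage_Ico_eq_div _ hab.le, setIntegral_oneSidedPower_of_nonneg (by norm_num) ha hab.le,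
    show (-1 / 2 : ℝ) + 1 = 1 / 2 by norm_num, ← Real.sqrt_eq_rpow, ← Real.sqrt_eq_rpow,
    div_le_div_iff₀ (sub_pos.mpr hab) hb]
  nlinarith [Real.sq_sqrt ha, Real.sq_sqrt (ha.trans hab.le), Real.sqrt_nonneg a]

theorem muckenhoupt_product_le {r : ℝ} (hr : 1 < r) {a b : ℝ} (hab : a < b)
    (h : 0 ≤ a ∨ b ≤ 0) :
    (⨍ x in Set.Ico a b, oneSidedPower ((r - 1) / 2) x) *
      (⨍ x in Set.Ico a b, oneSidedPower (-1 / 2) x) ^ (r - 1) ≤ 2 ^ (r - 1) := by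
  have hr' : 0 < r - 1 := sub_pos.mpr hr
  rcases h with ha | hb
  · have hb : 0 < b := ha.trans_lt hab
    calc _ ≤ b ^ ((r - 1) / 2) * (2 / √b) ^ (r - 1) := by
          gcongr
          · exact Real.rpow_nonneg (setAverage_oneSidedPower_nonneg _ a b) _
          · exact setAverage_oneSidedPower_le (by positivity) ha hab
          · exact setAverage_oneSidedPower_nonneg _ a b
          · exact setAverage_oneSidedPower_neg_half_le ha hab
      _ = 2 ^ (r - 1) := by
          have hpow : b ^ ((r - 1) / 2) = √b ^ (r - 1) := by
            rw [Real.sqrt_eq_rpow, ← Real.rpow_mul hb.le]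
            ring_nf
          have hsqrt : 0 < √b := Real.sqrt_pos.mpr hb
          rw [hpow, ← Real.mul_rpow hsqrt.le (by positivity), mul_div_cancel₀ _ hsqrt.ne']
  · rw [setAverage_oneSidedPower_of_nonpos _ hab hb, setAverage_oneSidedPower_of_nonpos _ hab hb,
      Real.one_rpow, mul_one]
    exact Real.one_le_rpow one_le_two hr'.le

theorem half_le_setAverage_oneSidedPower {p : ℝ} (hp : -1 < p) {ε : ℝ} (hε : 0 < ε) :
    1 / 2 ≤ ⨍ x in Set.Ico (-ε) ε, oneSidedPower p x := by
  have h : ∫ x in Set.Ico (-ε) 0, oneSidedPower p x ≤ ∫ x in Set.Ico (-ε) ε, oneSidedPower p x :=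
    setIntegral_mono_set (integrableOn_oneSidedPower hp _ _)
      (ae_of_all _ (oneSidedPower_nonneg p)) (Set.Ico_subset_Ico_right hε.le).eventuallyLE
  rw [setIntegral_oneSidedPower_of_nonpos p (by linarith) le_rfl] at h
  rw [setAverage_Ico_eq_div _ (by linarith), le_div_iff₀ (by linarith)]
  linarith

theorem inv_sqrt_le_setAverage_oneSidedPower {ε : ℝ} (hε : 0 < ε) :
    1 / √ε ≤ ⨍ x in Set.Ico (-ε) ε, oneSidedPower (-1 / 2) x := by
  have h : ∫ x in Set.Ico 0 ε, oneSidedPower (-1 / 2) x ≤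
      ∫ x in Set.Ico (-ε) ε, oneSidedPower (-1 / 2) x :=
    setIntegral_mono_set (integrableOn_oneSidedPower (by norm_num) _ _)
      (ae_of_all _ (oneSidedPower_nonneg _))
      (Set.Ico_subset_Ico_left (by linarith)).eventuallyLE
  rw [setIntegral_oneSidedPower_of_nonneg (by norm_num) le_rfl hε.le,
    show (-1 / 2 : ℝ) + 1 = 1 / 2 by norm_num, ← Real.sqrt_eq_rpow, ← Real.sqrt_eq_rpow,
    Real.sqrt_zero] at h
  have hs : 0 < √ε := Real.sqrt_pos.mpr hε
  rw [setAverage_Ico_eq_div _ (by linarith), div_le_div_iff₀ hs (by linarith)]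
  nlinarith [Real.sq_sqrt hε.le]

theorem exists_muckenhoupt_product_gt {r : ℝ} (hr : 1 < r) (M : ℝ) :
    ∃ ε : ℝ, 0 < ε ∧ M < (⨍ x in Set.Ico (-ε) ε, oneSidedPower ((r - 1) / 2) x) *
      (⨍ x in Set.Ico (-ε) ε, oneSidedPower (-1 / 2) x) ^ (r - 1) := by
  have hr' : 0 < r - 1 := sub_pos.mpr hr
  have hy : 0 < 2 * |M| + 2 := by positivity
  set z : ℝ := (2 * |M| + 2) ^ (r - 1)⁻¹ with hz
  have hz0 : 0 < z := Real.rpow_pos_of_pos hy _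
  have hε : 0 < (z⁻¹) ^ 2 := by positivity
  refine ⟨(z⁻¹) ^ 2, hε, ?_⟩
  have hv := inv_sqrt_le_setAverage_oneSidedPower hε
  rw [Real.sqrt_sq (by positivity), one_div, inv_inv] at hv
  calc M ≤ |M| := le_abs_self M
    _ < 1 / 2 * z ^ (r - 1) := by
        rw [hz, Real.rpow_inv_rpow hy.le hr'.ne']
        linarith
    _ ≤ _ :=
        mul_le_mul (half_le_setAverage_oneSidedPower (by linarith) hε)
          (Real.rpow_le_rpow hz0.le hv hr'.le) (Real.rpow_nonneg hz0.le _)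
          (setAverage_oneSidedPower_nonneg _ _ _)

/-- For every `1 < r < ∞` and every finite set `S` of integers `≥ 2`, there exists a
nonnegative locally integrable weight `w`, positive a.e. and with `w^{-1/(r-1)}` locally
integrable, whose Muckenhoupt `A_r` characteristic is finite over `n`-adic intervals for
every `n ∈ S` (so `w ∈ A_r^n`), but infinite over all nondegenerate bounded intervals
(so `w ∉ A_r`). -/
theorem muckenhoupt_intersection_ne (r : ℝ) (hr : 1 < r)
    (S : Finset ℕ) (hS : ∀ n ∈ S, 2 ≤ n) :
    ∃ w : ℝ → ℝ, (∀ x, 0 ≤ w x) ∧ LocallyIntegrable w volume ∧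
      (∀ᵐ x ∂(volume : Measure ℝ), 0 < w x) ∧
      LocallyIntegrable (fun x => (w x) ^ (-1 / (r - 1))) volume ∧
      (∀ n ∈ S, ∃ M : ℝ, ∀ m k : ℤ,
        (⨍ x in adicInterval n m k, w x) *
          (⨍ x in adicInterval n m k, (w x) ^ (-1 / (r - 1))) ^ (r - 1) ≤ M) ∧
      ¬ ∃ M : ℝ, ∀ a b : ℝ, a < b →
        (⨍ x in Set.Ico a b, w x) *
          (⨍ x in Set.Ico a b, (w x) ^ (-1 / (r - 1))) ^ (r - 1) ≤ M := by
  have hr' : 0 < r - 1 := sub_pos.mpr hr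
  have hdual : (fun x => oneSidedPower ((r - 1) / 2) x ^ (-1 / (r - 1))) =
      oneSidedPower (-1 / 2) := by
    funext x
    rw [oneSidedPower_rpow]
    congr 1
    field_simp
  have hdual' := congrFun hdual
  refine ⟨oneSidedPower ((r - 1) / 2), oneSidedPower_nonneg _,
    locallyIntegrable_oneSidedPower (by linarith), ?_, ?_, ?_, ?_⟩
  · filter_upwards [Measure.ae_ne volume (0 : ℝ)] with x hx using oneSidedPower_pos _ hx
  · rw [hdual]
    exact locallyIntegrable_oneSidedPower (by norm_num)
  · intro n hn
    refine ⟨2 ^ (r - 1), fun m k => ?_⟩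
    have hpos : (0 : ℝ) < (n : ℝ) ^ m :=
      zpow_pos (by exact_mod_cast zero_lt_two.trans_le (hS n hn)) m
    simp only [hdual']
    refine muckenhoupt_product_le hr (div_lt_div_of_pos_right (by linarith) hpos) ?_
    rcases le_or_gt k 0 with hk | hk
    · exact Or.inr (div_nonpos_of_nonpos_of_nonneg (by exact_mod_cast hk) hpos.le)
    · have hk' : (1 : ℝ) ≤ k := by exact_mod_cast hk
      exact Or.inl (div_nonneg (by linarith) hpos.le)
  · rintro ⟨M, hM⟩
    simp only [hdual'] at hM
    obtain ⟨ε, hε, hlt⟩ := exists_muckenhoupt_product_gt hr M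
    exact (hlt.trans_le (hM (-ε) ε (by linarith))).false
end

section
/- Let f : ℝ → ℝ be the indicator function of [0, ∞), i.e., f(x) = 1 for x ≥ 0 and f(x) = 0 for x < 0. Then: (i) for every integer n ≥ 2 and every n-adic interval I, the mean oscillation ⨍_I |f − ⨍_I f| equals 0 (so f lies in VMO_n for every n ≥ 2); and (ii) for every δ > 0 there exists a bounded interval I with 0 < |I| < δ and ⨍_I |f − ⨍_I f| = 1/2. Consequently, lim_{δ→0} sup_{I : |I|<δ} ⨍_I |f − ⨍_I f| ≥ 1/2 > 0, so f does not lie in VMO; hence the intersection of VMO_n over all n ∈ ℕ, n ≥ 2, is not equal to VMO. -/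
open MeasureTheory

/-- The indicator function of `[0, ∞)`. -/
noncomputable def stepFun : ℝ → ℝ := fun x => if 0 ≤ x then 1 else 0

theorem meanOsc_eq_zero_of_eqOn_const {f : ℝ → ℝ} {s : Set ℝ} {c : ℝ} (hs : MeasurableSet s)
    (h0 : volume s ≠ 0) (ht : volume s ≠ ⊤) (hf : ∀ x ∈ s, f x = c) : meanOsc f s = 0 := by
  have havg : ⨍ y in s, f y = c := by
    rw [setAverage_congr_fun hs (g := fun _ => c) (.of_forall hf), setAverage_const h0 ht]
  have hosc : ∀ x ∈ s, |f x - ⨍ y in s, f y| = 0 := fun x hx => by simp [havg, hf x hx]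
  rw [meanOsc, setAverage_congr_fun hs (g := fun _ => (0 : ℝ)) (.of_forall hosc),
    setAverage_const h0 ht]

theorem stepFun_eq_indicator : stepFun = (Set.Ici 0).indicator fun _ => (1 : ℝ) := by
  ext x
  simp [stepFun, Set.indicator_apply]

theorem setAverage_stepFun_Ico_neg_self {c : ℝ} (hc : 0 < c) :
    ⨍ y in Set.Ico (-c) c, stepFun y = 1 / 2 := by
  have hset : Set.Ico (-c) c ∩ Set.Ici 0 = Set.Ico 0 c := by
    ext x
    simp only [Set.mem_inter_iff, Set.mem_Ico, Set.mem_Ici]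
    exact ⟨fun h => ⟨h.2, h.1.2⟩, fun h => ⟨⟨by linarith [h.1], h.2⟩, h.1⟩⟩
  rw [setAverage_eq, stepFun_eq_indicator, setIntegral_indicator measurableSet_Ici, hset,
    setIntegral_const, Real.volume_real_Ico_of_le (by linarith),
    Real.volume_real_Ico_of_le hc.le]
  simp only [smul_eq_mul]
  field_simp
  ring

theorem meanOsc_stepFun_Ico_neg_self {c : ℝ} (hc : 0 < c) :
    meanOsc stepFun (Set.Ico (-c) c) = 1 / 2 := by
  have hosc : ∀ x, |stepFun x - 1 / 2| = 1 / 2 := fun x => by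
    unfold stepFun
    split_ifs <;> norm_num [abs_of_pos, abs_of_neg]
  simp_rw [meanOsc, setAverage_stepFun_Ico_neg_self hc, hosc]
  refine setAverage_const ?_ measure_Ico_lt_top.ne _
  simp [Real.volume_Ico, hc]

theorem meanOsc_stepFun_adicInterval {n : ℕ} (hn : 0 < n) (m k : ℤ) :
    meanOsc stepFun (adicInterval n m k) = 0 := by
  have hp : (0 : ℝ) < (n : ℝ) ^ m := by positivity
  have h0 : volume (adicInterval n m k) ≠ 0 := by
    rw [adicInterval, Real.volume_Ico, ← sub_div, sub_sub_cancel]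
    simp [hp]
  have ht : volume (adicInterval n m k) ≠ ⊤ := measure_Ico_lt_top.ne
  rcases le_or_gt k 0 with hk | hk
  · refine meanOsc_eq_zero_of_eqOn_const (c := 0) measurableSet_Ico h0 ht fun x hx => ?_
    have hk' : (k : ℝ) ≤ 0 := by exact_mod_cast hk
    exact if_neg (hx.2.trans_le (div_nonpos_of_nonpos_of_nonneg hk' hp.le)).not_ge
  · refine meanOsc_eq_zero_of_eqOn_const (c := 1) measurableSet_Ico h0 ht fun x hx => ?_
    have hk' : (1 : ℝ) ≤ k := by exact_mod_cast hk
    exact if_pos ((div_nonneg (sub_nonneg.2 hk') hp.le).trans hx.1)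

/-- For the indicator function `f` of `[0, ∞)`: (i) the mean oscillation of `f` over every
`n`-adic interval (any `n ≥ 2`) vanishes, so `f ∈ VMO_n` for all `n ≥ 2`; and (ii) for
every `δ > 0` there is a bounded interval of length `< δ` on which the mean oscillation of
`f` equals `1/2`, so `f ∉ VMO`: the intersection of the `VMO_n` is not `VMO`. -/
theorem step_function_vmo :
    (∀ n : ℕ, 2 ≤ n → ∀ m k : ℤ, meanOsc stepFun (adicInterval n m k) = 0) ∧
    (∀ δ : ℝ, 0 < δ → ∃ a b : ℝ, a < b ∧ b - a < δ ∧
      meanOsc stepFun (Set.Ico a b) = 1 / 2) := by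
  refine ⟨fun n hn m k => meanOsc_stepFun_adicInterval (by omega) m k, fun δ hδ => ?_⟩
  exact ⟨-(δ / 4), δ / 4, by linarith, by linarith, meanOsc_stepFun_Ico_neg_self (by linarith)⟩
end

section
/- Let p and q be primes with p > q, and let m and n be fixed positive integers. Given any interval J̃ ⊆ [0,1] of positive length and any ε > 0, there exists a q-adic interval I ⊆ J̃ such that 0 < Y(J) − Z(I) ≤ ε·|I|, where J is the smallest (p^m q^n)-adic interval containing I. -/
open MeasureTheory

/-- `Y(I)` : the right endpoint of the first `n`-adic child of `I = [(k-1)/n^m, k/n^m)`. -/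
noncomputable def Ypt (n : ℕ) (m k : ℤ) : ℝ :=
  ((k : ℝ) - 1) / (n : ℝ) ^ m + 1 / (n : ℝ) ^ (m + 1)

/-- `Z(I)` : the left endpoint of the last `n`-adic child of `I = [(k-1)/n^m, k/n^m)`. -/
noncomputable def Zpt (n : ℕ) (m k : ℤ) : ℝ :=
  ((k : ℝ) - 1) / (n : ℝ) ^ m + ((n : ℝ) - 1) / (n : ℝ) ^ (m + 1)

theorem exists_one_add_pow_eq {R : Type*} [CommRing R] (x : R) (j : ℕ) :
    ∃ t : R, (1 + x) ^ j = 1 + j * x + x ^ 2 * t := by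
  induction j with
  | zero => exact ⟨0, by simp⟩
  | succ j ih =>
    obtain ⟨t, ht⟩ := ih
    refine ⟨j + t + x * t, ?_⟩
    rw [pow_succ, ht]
    push_cast
    ring

theorem exists_nat_dvd_sub_mul {p : ℕ} (hp : p.Prime) {v : ℤ} (hv : ¬ (p : ℤ) ∣ v) (w : ℤ) :
    ∃ j : ℕ, (p : ℤ) ∣ w - j * v := by
  have := Fact.mk hp
  refine ⟨((w : ZMod p) / v).val, ?_⟩
  rw [← ZMod.intCast_zmod_eq_zero_iff_dvd] at hv ⊢
  push_cast
  rw [ZMod.natCast_zmod_val, div_mul_cancel₀ _ hv, sub_self]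

/-- Lifting the exponent: some power of `q` is `1` modulo exactly `p ^ (c + k)`, for every `k`. -/
theorem exists_pow_eq_one_add_prime_pow_mul {p q : ℕ} (hp : p.Prime) (hp2 : Odd p) (hq : 1 < q)
    (hpq : ¬ p ∣ q) :
    ∃ c : ℕ, 0 < c ∧ ∀ k : ℕ, ∃ e : ℕ, 0 < e ∧ ∃ u : ℤ,
      (q : ℤ) ^ e = 1 + (p : ℤ) ^ (c + k) * u ∧ ¬ (p : ℤ) ∣ u := by
  have := Fact.mk hp
  have hp1 : 0 < p - 1 := Nat.sub_pos_of_lt hp.one_lt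
  have hcop : Nat.Coprime q p := ((Nat.Prime.coprime_iff_not_dvd hp).2 hpq).symm
  have hg1 : 1 < q ^ (p - 1) := Nat.one_lt_pow hp1.ne' hq
  have hdvd : p ∣ q ^ (p - 1) - 1 := by
    have h := Nat.ModEq.pow_totient hcop
    rw [Nat.totient_prime hp] at h
    exact (Nat.modEq_iff_dvd' hg1.le).1 h.symm
  refine ⟨padicValNat p (q ^ (p - 1) - 1),
    one_le_padicValNat_of_dvd (by omega) hdvd, fun k => ⟨(p - 1) * p ^ k,
    Nat.mul_pos hp1 (pow_pos hp.pos k), ?_⟩⟩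
  have hlte := padicValNat.pow_sub_pow hp2 hg1 hdvd (fun h => hpq (hp.dvd_of_dvd_pow h))
    (pow_pos hp.pos k).ne'
  rw [one_pow, padicValNat.prime_pow, ← pow_mul] at hlte
  have hlt : 1 < q ^ ((p - 1) * p ^ k) :=
    Nat.one_lt_pow (Nat.mul_pos hp1 (pow_pos hp.pos k)).ne' hq
  rw [← hlte]
  set w := q ^ ((p - 1) * p ^ k) - 1 with hw
  have hw0 : w ≠ 0 := by omega
  obtain ⟨u, hu⟩ : p ^ padicValNat p w ∣ w := pow_padicValNat_dvd
  refine ⟨(u : ℤ), ?_, ?_⟩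
  · have h1 : q ^ ((p - 1) * p ^ k) = 1 + p ^ padicValNat p w * u := by omega
    exact_mod_cast h1
  · intro h
    obtain ⟨v, rfl⟩ := Int.natCast_dvd_natCast.1 h
    refine pow_succ_padicValNat_not_dvd hw0 (p := p) ⟨v, ?_⟩
    rw [pow_succ, mul_assoc]
    exact hu

/-- The powers of `q` modulo `p ^ s` fill out the residue classes that are `1` modulo a fixed
power `p ^ c` with `c` independent of `s`. -/
theorem exists_pow_mul_modEq {p q : ℕ} (hp : p.Prime) (hp2 : Odd p) (hq : 1 < q)
    (hpq : ¬ p ∣ q) :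
    ∃ c : ℕ, ∀ s : ℕ, c ≤ s → ∀ A y : ℤ, ¬ (p : ℤ) ∣ A → (p : ℤ) ^ c ∣ y - A →
      ∀ B : ℕ, ∃ b : ℕ, B ≤ b ∧ (p : ℤ) ^ s ∣ y - (q : ℤ) ^ b * A := by
  obtain ⟨c, hc0, hc⟩ := exists_pow_eq_one_add_prime_pow_mul hp hp2 hq hpq
  have hpZ : Prime (p : ℤ) := Nat.prime_iff_prime_int.1 hp
  refine ⟨c, fun s hs A y hA hy B => ?_⟩
  obtain ⟨k, rfl⟩ := Nat.exists_eq_add_of_le hs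
  clear hs
  induction k with
  | zero =>
    obtain ⟨e, he, u, hu, -⟩ := hc 0
    refine ⟨e * B, Nat.le_mul_of_pos_left B he, ?_⟩
    have h1 : (p : ℤ) ^ c ∣ (q : ℤ) ^ (e * B) - 1 := by
      rw [pow_mul]
      refine dvd_trans ⟨u, ?_⟩ (sub_one_dvd_pow_sub_one ((q : ℤ) ^ e) B)
      rw [hu]; simp
    have h2 : y - (q : ℤ) ^ (e * B) * A = (y - A) - ((q : ℤ) ^ (e * B) - 1) * A := by ring
    rw [add_zero, h2]
    exact dvd_sub hy (h1.mul_right A)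
  | succ k ih =>
    obtain ⟨b, hb, w, hw⟩ := ih
    obtain ⟨e, he, u, hu, hpu⟩ := hc k
    have hunit : ¬ (p : ℤ) ∣ u * ((q : ℤ) ^ b * A) := by
      intro h
      rcases hpZ.dvd_or_dvd h with h | h
      · exact hpu h
      rcases hpZ.dvd_or_dvd h with h | h
      · exact hpq (Int.natCast_dvd_natCast.1 (hpZ.dvd_of_dvd_pow h))
      · exact hA h
    obtain ⟨j, z, hj⟩ := exists_nat_dvd_sub_mul hp hunit w
    obtain ⟨t, ht⟩ := exists_one_add_pow_eq ((p : ℤ) ^ (c + k) * u) j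
    obtain ⟨r, hr⟩ : (p : ℤ) ∣ (p : ℤ) ^ (c + k) := dvd_pow_self _ (by omega)
    refine ⟨b + e * j, by omega, z - r * (u ^ 2 * t * (q : ℤ) ^ b * A), ?_⟩
    rw [pow_add, pow_mul, hu, ht, ← add_assoc c k 1, pow_succ]
    linear_combination hw + (p : ℤ) ^ (c + k) * hj
      - (p : ℤ) ^ (c + k) * u ^ 2 * t * (q : ℤ) ^ b * A * hr

/-- An interval of length at least `d` contains an integer of any given residue class modulo `d`. -/
theorem exists_int_mem_Ioc_dvd_sub (A : ℤ) {d : ℕ} (hd : 0 < d) {x z : ℝ} (h : x + d ≤ z) :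
    ∃ y : ℤ, x < y ∧ (y : ℝ) ≤ z ∧ (d : ℤ) ∣ y - A := by
  have hd' : (0 : ℝ) < d := by exact_mod_cast hd
  have h1 := Int.floor_le ((z - A) / d)
  have h2 := Int.lt_floor_add_one ((z - A) / d)
  rw [le_div_iff₀ hd'] at h1
  rw [div_lt_iff₀ hd'] at h2
  refine ⟨A + d * ⌊(z - A) / d⌋, ?_, ?_, ⟨_, add_sub_cancel_left _ _⟩⟩ <;> push_cast <;> nlinarith

/-- An `N`-adic interval whose interior contains the right endpoint of the first child of another
`N`-adic interval contains that whole interval. -/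
theorem adicInterval_subset_of_Ypt {N : ℕ} (hN : 2 ≤ N) {M k M' k' : ℤ}
    (h1 : ((k' : ℝ) - 1) / (N : ℝ) ^ M' < Ypt N M k) (h2 : Ypt N M k < k' / (N : ℝ) ^ M') :
    adicInterval N M k ⊆ adicInterval N M' k' := by
  have hN0 : (0 : ℝ) < N := by positivity
  have hN2 : (2 : ℝ) ≤ N := by exact_mod_cast hN
  have hY : Ypt N M k = ((k - 1) * N + 1) / (N : ℝ) ^ (M + 1) := by
    rw [Ypt, zpow_add_one₀ hN0.ne']
    field_simp
  rcases le_or_gt M' M with hle | hlt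
  · obtain ⟨d, rfl⟩ := Int.le.dest hle
    have hP : (0 : ℝ) < (N : ℝ) ^ M' := by positivity
    have hD : (0 : ℝ) < (N : ℝ) ^ d := by positivity
    have hM1 : (N : ℝ) ^ (M' + d + 1 : ℤ) = N ^ M' * N ^ d * N := by
      rw [zpow_add_one₀ hN0.ne', zpow_add₀ hN0.ne', zpow_natCast]
    rw [hY, hM1] at h1 h2
    rw [div_lt_div_iff₀ hP (by positivity)] at h1
    rw [div_lt_div_iff₀ (by positivity) hP] at h2
    have h1' : ((k' : ℝ) - 1) * N ^ d < k := by
      have : ((k' : ℝ) - 1) * N ^ d * N < (k - 1) * N + 1 := by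
        by_contra! hcon
        nlinarith [mul_le_mul_of_nonneg_left hcon hP.le]
      nlinarith
    have h2' : (k : ℝ) - 1 < k' * N ^ d := by
      have : ((k : ℝ) - 1) * N + 1 < k' * N ^ d * N := by
        by_contra! hcon
        nlinarith [mul_le_mul_of_nonneg_left hcon hP.le]
      nlinarith
    have h1i : (k' - 1) * (N : ℤ) ^ d ≤ k - 1 := by
      have : (k' - 1) * (N : ℤ) ^ d < k := by exact_mod_cast h1'
      omega
    have h2i : k ≤ k' * (N : ℤ) ^ d := by
      have : k - 1 < k' * (N : ℤ) ^ d := by exact_mod_cast h2'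
      omega
    have h1r : ((k' : ℝ) - 1) * N ^ d ≤ k - 1 := by exact_mod_cast h1i
    have h2r : (k : ℝ) ≤ k' * N ^ d := by exact_mod_cast h2i
    have hM : (N : ℝ) ^ (M' + d : ℤ) = N ^ M' * N ^ d := by
      rw [zpow_add₀ hN0.ne', zpow_natCast]
    refine Set.Ico_subset_Ico ?_ ?_
    · rw [hM, div_le_div_iff₀ hP (by positivity)]
      nlinarith [mul_le_mul_of_nonneg_left h1r hP.le]
    · rw [hM, div_le_div_iff₀ (by positivity) hP]
      nlinarith [mul_le_mul_of_nonneg_left h2r hP.le]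
  · exfalso
    obtain ⟨d, rfl⟩ := Int.le.dest (Int.add_one_le_of_lt hlt)
    have hD : (N : ℝ) ^ (M + 1 + d : ℤ) = N ^ (M + 1) * N ^ d := by
      rw [zpow_add₀ hN0.ne', zpow_natCast]
    have hP : (0 : ℝ) < (N : ℝ) ^ (M + 1) := by positivity
    have hD0 : (0 : ℝ) < (N : ℝ) ^ d := by positivity
    have hY' : Ypt N M k = (((k - 1) * N + 1) * N ^ d) / (N : ℝ) ^ (M + 1 + d : ℤ) := by
      rw [hY, hD, mul_div_mul_right _ _ hD0.ne']
    rw [hY', div_lt_div_iff_of_pos_right (by positivity)] at h1 h2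
    have h1i : k' - 1 < ((k - 1) * N + 1) * (N : ℤ) ^ d := by exact_mod_cast h1
    have h2i : ((k - 1) * N + 1) * (N : ℤ) ^ d < k' := by exact_mod_cast h2
    omega

/-- A nondegenerate interval contains an `N`-adic interval of every small enough length. -/
theorem exists_adicInterval_subset_Icc {N : ℕ} (hN : 2 ≤ N) {x y : ℝ} {M : ℕ}
    (h : 2 / (y - x) ≤ (N : ℝ) ^ M) (hxy : x < y) :
    ∃ k : ℤ, adicInterval N M k ⊆ Set.Icc x y := by
  have hP : (0 : ℝ) < (N : ℝ) ^ M := by positivity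
  rw [div_le_iff₀ (sub_pos.2 hxy)] at h
  have h1 := Int.le_ceil (x * (N : ℝ) ^ M)
  have h2 := Int.ceil_lt_add_one (x * (N : ℝ) ^ M)
  refine ⟨⌈x * (N : ℝ) ^ M⌉ + 1, Set.Ico_subset_Icc_self.trans (Set.Icc_subset_Icc ?_ ?_)⟩
  · rw [zpow_natCast, le_div_iff₀ hP]
    push_cast
    linarith
  · rw [zpow_natCast, div_le_iff₀ hP]
    push_cast
    linarith

/-- Let `p > q` be primes and `m, n` fixed positive integers. Given any interval
`J̃ ⊆ [0,1]` of positive length and any `ε > 0`, there exists a `q`-adic interval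
`I ⊆ J̃` with `0 < Y(J) − Z(I) ≤ ε·|I|`, where `J` is the smallest `p^m q^n`-adic
interval containing `I`. -/
theorem interval_selection_pmqn (p q : ℕ) (hp : p.Prime) (hq : q.Prime) (hqp : q < p)
    (m n : ℕ) (hm : 0 < m) (hn : 0 < n)
    (Jt : Set ℝ) (hJt : Jt ⊆ Set.Icc 0 1) (hconn : Jt.OrdConnected)
    (hpos : ∃ x ∈ Jt, ∃ y ∈ Jt, x < y)
    (ε : ℝ) (hε : 0 < ε) :
    ∃ mI kI : ℤ, adicInterval q mI kI ⊆ Jt ∧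
      ∃ mJ kJ : ℤ,
        adicInterval q mI kI ⊆ adicInterval (p ^ m * q ^ n) mJ kJ ∧
        (∀ mJ' kJ' : ℤ, adicInterval q mI kI ⊆ adicInterval (p ^ m * q ^ n) mJ' kJ' →
          adicInterval (p ^ m * q ^ n) mJ kJ ⊆ adicInterval (p ^ m * q ^ n) mJ' kJ') ∧
        0 < Ypt (p ^ m * q ^ n) mJ kJ - Zpt q mI kI ∧
        Ypt (p ^ m * q ^ n) mJ kJ - Zpt q mI kI ≤ ε * ((q : ℝ) ^ mI)⁻¹ := by
  obtain ⟨x, hx, y, hy, hxy⟩ := hpos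
  have hp2 : Odd p := hp.odd_of_ne_two (by have := hq.two_le; omega)
  have hpq : ¬ p ∣ q := fun h => absurd (Nat.le_of_dvd hq.pos h) (by omega)
  obtain ⟨c, hc⟩ := exists_pow_mul_modEq hp hp2 hq.one_lt hpq
  have hpN : p ≤ p ^ m * q ^ n :=
    (Nat.le_self_pow hm.ne' p).trans (Nat.le_mul_of_pos_right _ (pow_pos hq.pos n))
  have hN : 2 ≤ p ^ m * q ^ n := hp.two_le.trans hpN
  set N := p ^ m * q ^ n with hNdef
  have hN2 : (2 : ℝ) ≤ N := by exact_mod_cast hN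
  have hN0 : (0 : ℝ) < N := by positivity
  have hq0 : (0 : ℝ) < q := by exact_mod_cast hq.pos
  have hp1 : (1 : ℝ) < p := by exact_mod_cast hp.one_lt
  obtain ⟨δ, hδ0, hδε, hδq⟩ : ∃ δ : ℝ, 0 < δ ∧ δ ≤ ε ∧ δ < 1 / q :=
    ⟨min ε (1 / q / 2), by positivity, min_le_left _ _,
      (min_le_right _ _).trans_lt (half_lt_self (by positivity))⟩
  obtain ⟨M, hM1, hM2⟩ : ∃ M : ℕ, 2 / (y - x) ≤ (p : ℝ) ^ M ∧ (p : ℝ) ^ c / δ ≤ (p : ℝ) ^ M := by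
    obtain ⟨M, hM⟩ := pow_unbounded_of_one_lt (max (2 / (y - x)) ((p : ℝ) ^ c / δ)) hp1
    exact ⟨M, (le_max_left _ _).trans hM.le, (le_max_right _ _).trans hM.le⟩
  obtain ⟨k, hk⟩ := exists_adicInterval_subset_Icc hN (M := M)
    (hM1.trans (pow_le_pow_left₀ (by positivity) (by exact_mod_cast hpN) M)) hxy
  set s := m * (M + 1) with hs
  set t := n * (M + 1) with ht
  have hMs : M ≤ s := (Nat.le_succ M).trans (Nat.le_mul_of_pos_left _ hm)
  have hps : (p : ℝ) ^ c / δ ≤ (p : ℝ) ^ s := hM2.trans (pow_le_pow_right₀ hp1.le hMs)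
  have hps0 : (0 : ℝ) < (p : ℝ) ^ s := by positivity
  have hpc : (p : ℝ) ^ c ≤ δ * (p : ℝ) ^ s := by
    rwa [div_le_iff₀ hδ0, mul_comm] at hps
  have hδ1 : δ < 1 := hδq.trans_le (by
    rw [div_le_one hq0]
    exact_mod_cast hq.one_lt.le)
  have hcs : c ≤ s := by
    rw [← pow_le_pow_iff_right₀ hp1]
    nlinarith
  have hNs : (N : ℝ) ^ ((M : ℤ) + 1) = p ^ s * q ^ t := by
    rw [hNdef, ← Nat.cast_succ, zpow_natCast, hs, ht, pow_mul, pow_mul, ← mul_pow]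
    push_cast
    rfl
  set A : ℤ := (k - 1) * N + 1 with hA
  have hpA : ¬ (p : ℤ) ∣ A := by
    intro h
    have hpN' : (p : ℤ) ∣ N := by
      exact_mod_cast (dvd_pow_self p hm.ne').mul_right (q ^ n)
    have h1 : (p : ℤ) ∣ 1 := (dvd_add_right (hpN'.mul_left (k - 1))).1 h
    exact hp.one_lt.ne' (Nat.dvd_one.1 (by exact_mod_cast h1))
  obtain ⟨r, hr1, hr2, hrA⟩ := exists_int_mem_Ioc_dvd_sub A (pow_pos hp.pos c)
    (x := (1 - 1 / q) * (p : ℝ) ^ s) (z := (1 - 1 / q + δ) * (p : ℝ) ^ s) (by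
      push_cast
      linarith)
  push_cast at hrA
  obtain ⟨b, hb, w, hw⟩ := hc s hcs A r hpA hrA (p ^ s)
  have hwR : (q : ℝ) ^ b * A = r + p ^ s * (-w) := by
    have h : (q : ℤ) ^ b * A = r + p ^ s * (-w) := by linear_combination -hw
    exact_mod_cast h
  have hqb : (p : ℝ) ^ s ≤ (q : ℝ) ^ b := by
    exact_mod_cast hb.trans (Nat.lt_pow_self hq.one_lt).le
  set Q : ℝ := (q : ℝ) ^ (b + t) with hQ
  have hQ0 : 0 < Q := by positivity
  have hQz : (q : ℝ) ^ ((b + t : ℕ) : ℤ) = Q := zpow_natCast _ _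
  have hY : Ypt N M k = (r / p ^ s - w) / Q := by
    have h : Ypt N M k = A / (N : ℝ) ^ ((M : ℤ) + 1) := by
      rw [Ypt, zpow_add_one₀ hN0.ne', hA]
      push_cast
      field_simp
    rw [h, hNs, hQ, pow_add, div_eq_div_iff (by positivity) (by positivity)]
    have h2 : ((r : ℝ) / p ^ s - w) * p ^ s = r + p ^ s * (-w) := by
      field_simp
      ring
    linear_combination (q : ℝ) ^ t * hwR - (q : ℝ) ^ t * h2
  rw [← lt_div_iff₀ hps0] at hr1
  rw [← div_le_iff₀ hps0] at hr2
  have hq1 : 1 / (q : ℝ) < 1 := by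
    rw [div_lt_one hq0]
    exact_mod_cast hq.one_lt
  have hleft : (((-w + 1 : ℤ) : ℝ) - 1) / Q < Ypt N M k := by
    rw [hY, div_lt_div_iff_of_pos_right hQ0]
    push_cast
    linarith
  have hright : Ypt N M k < ((-w + 1 : ℤ) : ℝ) / Q := by
    rw [hY, div_lt_div_iff_of_pos_right hQ0]
    push_cast
    linarith
  have hZ : Zpt q ((b + t : ℕ) : ℤ) (-w + 1) = (-w + (1 - 1 / q)) / Q := by
    rw [Zpt, zpow_add_one₀ hq0.ne', hQz]
    push_cast
    field_simp
    ring
  have hlen : 1 / Q ≤ 1 / (N : ℝ) ^ ((M : ℤ) + 1) := by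
    rw [hNs, hQ, pow_add]
    gcongr
  have hIJ : adicInterval q ((b + t : ℕ) : ℤ) (-w + 1) ⊆ adicInterval N M k := by
    have hsplit : (((-w + 1 : ℤ) : ℝ) - 1) / Q = ((-w + 1 : ℤ) : ℝ) / Q - 1 / Q := by
      rw [sub_div]
    have hstep : (2 : ℝ) * (1 / (N : ℝ) ^ ((M : ℤ) + 1)) ≤ 1 / (N : ℝ) ^ (M : ℤ) := by
      rw [zpow_add_one₀ hN0.ne', one_div, mul_inv, one_div, mul_left_comm, ← div_eq_mul_inv 2]
      exact mul_le_of_le_one_right (by positivity) ((div_le_one hN0).2 hN2)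
    have hYd : Ypt N M k = ((k : ℝ) - 1) / (N : ℝ) ^ (M : ℤ) + 1 / (N : ℝ) ^ ((M : ℤ) + 1) := rfl
    have hkd : (k : ℝ) / (N : ℝ) ^ (M : ℤ)
        = ((k : ℝ) - 1) / (N : ℝ) ^ (M : ℤ) + 1 / (N : ℝ) ^ (M : ℤ) := by
      rw [← add_div, sub_add_cancel]
    refine Set.Ico_subset_Ico ?_ ?_ <;> rw [hQz] <;> linarith
  refine ⟨(b + t : ℕ), -w + 1, (hIJ.trans hk).trans (hconn.out hx hy), M, k, hIJ, ?_, ?_, ?_⟩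
  · intro M' k' hsub
    have hne : (((-w + 1 : ℤ) : ℝ) - 1) / (q : ℝ) ^ ((b + t : ℕ) : ℤ)
        < ((-w + 1 : ℤ) : ℝ) / (q : ℝ) ^ ((b + t : ℕ) : ℤ) := by
      rw [hQz]
      exact hleft.trans hright
    obtain ⟨h1, h2⟩ := (Set.Ico_subset_Ico_iff hne).1 hsub
    rw [hQz] at h1 h2
    exact adicInterval_subset_of_Ypt hN (h1.trans_lt hleft) (hright.trans_le h2)
  · rw [hY, hZ, ← sub_div]
    exact div_pos (by linarith) hQ0
  · rw [hY, hZ, ← sub_div, hQz, div_eq_mul_inv]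
    exact mul_le_mul_of_nonneg_right (by linarith) (by positivity)
end

section
/- Let p be a prime, let v > 1 be an integer coprime to p, let n ≥ 1 be such that u = p^n > v, and let c′_1, …, c′_k be positive integers. Then there exist a sequence of v-adic intervals I_ℓ ⊆ [0,1) (ℓ ≥ 1) and positive integers α_ℓ such that: (1) for each 1 ≤ i ≤ k, the intervals J^i_ℓ (ℓ ≥ 1) are pairwise disjoint and contained in [0,1), where J^i_ℓ is the smallest (u·c′_i)-adic interval containing I_ℓ; in particular the intervals I_ℓ are pairwise disjoint; (2) for each positive integer α, only finitely many ℓ satisfy α_ℓ = α; (3) for each ℓ and each i, there is a point ζ which is the right endpoint of the y-th (u·c′_i)-adic child of J^i_ℓ for some 1 ≤ y ≤ u·c′_i − 1, satisfying 0 < ζ − Z(I_ℓ) ≤ v^{−100·α_ℓ}·|I_ℓ|. -/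
open MeasureTheory

/-- The right endpoint of the `y`-th `n`-adic child of `[(k-1)/n^m, k/n^m)`. -/
noncomputable def childRight (n : ℕ) (m k : ℤ) (y : ℕ) : ℝ :=
  ((k : ℝ) - 1) / (n : ℝ) ^ m + (y : ℝ) / (n : ℝ) ^ (m + 1)

/-- Two `w`-adic intervals sharing a point are nested according to their levels. -/
theorem adicInterval_subset_of_mem {w : ℕ} (hw : 0 < w) {m m' k k' : ℤ} {x : ℝ} (hm : m' ≤ m)
    (hx : x ∈ adicInterval w m k) (hx' : x ∈ adicInterval w m' k') :
    adicInterval w m k ⊆ adicInterval w m' k' := by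
  obtain ⟨d, rfl⟩ := Int.le.dest hm
  have hw' : (0 : ℝ) < w := by exact_mod_cast hw
  have hP : (0 : ℝ) < (w : ℝ) ^ m' := zpow_pos hw' _
  have hD : (0 : ℝ) < (w : ℝ) ^ d := pow_pos hw' _
  have hsplit : (w : ℝ) ^ (m' + (d : ℤ)) = (w : ℝ) ^ m' * (w : ℝ) ^ d := by
    rw [zpow_add₀ hw'.ne', zpow_natCast]
  unfold adicInterval at *
  rw [hsplit] at hx ⊢
  obtain ⟨h1, h2⟩ := hx
  obtain ⟨h3, h4⟩ := hx'
  rw [div_le_iff₀ (by positivity)] at h1 h3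
  rw [lt_div_iff₀ (by positivity)] at h2 h4
  have h5 : (k' - 1) * (w : ℤ) ^ d < k := by
    have : ((k' : ℝ) - 1) * (w : ℝ) ^ d < k := by
      calc ((k' : ℝ) - 1) * (w : ℝ) ^ d ≤ x * (w : ℝ) ^ m' * (w : ℝ) ^ d := by gcongr
        _ < k := by linarith
    exact_mod_cast this
  have h6 : k - 1 < k' * (w : ℤ) ^ d := by
    have : (k : ℝ) - 1 < k' * (w : ℝ) ^ d := by
      calc (k : ℝ) - 1 ≤ x * (w : ℝ) ^ m' * (w : ℝ) ^ d := by linarith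
        _ < k' * (w : ℝ) ^ d := by gcongr
    exact_mod_cast this
  have h5' : ((k' : ℝ) - 1) * (w : ℝ) ^ d ≤ k - 1 := by
    exact_mod_cast Int.le_sub_one_of_lt h5
  have h6' : (k : ℝ) ≤ k' * (w : ℝ) ^ d := by
    exact_mod_cast (by omega : k ≤ k' * (w : ℤ) ^ d)
  apply Set.Ico_subset_Ico
  · rw [div_le_div_iff₀ hP (by positivity)]
    nlinarith
  · rw [div_le_div_iff₀ (by positivity) hP]
    nlinarith

theorem adicInterval_zero_one (w : ℕ) : adicInterval w 0 1 = Set.Ico 0 1 := by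
  simp [adicInterval]

theorem childRight_mem_adicInterval {w M k y : ℕ} (hyw : y < w) :
    childRight w M (k + 1 : ℕ) y ∈ adicInterval w M (k + 1 : ℕ) := by
  have hw : (0 : ℝ) < w := by exact_mod_cast (by omega : 0 < w)
  have hy : (y : ℝ) < w := by exact_mod_cast hyw
  have h : ((M : ℤ) + 1) = ((M + 1 : ℕ) : ℤ) := by push_cast; ring
  simp only [childRight, adicInterval, h, zpow_natCast, Set.mem_Ico]
  push_cast
  refine ⟨le_add_of_nonneg_right (by positivity), ?_⟩
  rw [pow_succ, div_add_div _ _ (by positivity) (by positivity),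
    div_lt_div_iff₀ (by positivity) (by positivity)]
  have : 0 < (w : ℝ) ^ M * (w : ℝ) ^ M := by positivity
  nlinarith

/-- A reduced fraction `r / p ^ t` is an interior child endpoint of a `w`-adic interval,
for every multiple `w` of `p`. -/
theorem exists_childRight_eq {p w t r : ℕ} (hp : 1 < p) (hpw : p ∣ w) (hw : 0 < w) (ht : 0 < t)
    (hr : Nat.Coprime p r) :
    ∃ M k y : ℕ, 1 ≤ y ∧ y < w ∧ M < t ∧ p ^ t ≤ w ^ (M + 1) ∧
      childRight w M (k + 1 : ℕ) y = (r : ℝ) / (p : ℝ) ^ t := by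
  classical
  have hex : ∃ a, p ^ t ∣ w ^ a := ⟨t, pow_dvd_pow_of_dvd hpw t⟩
  obtain ⟨M, hM⟩ : ∃ M, Nat.find hex = M + 1 := by
    refine Nat.exists_eq_succ_of_ne_zero fun h0 => ?_
    have := Nat.find_spec hex
    rw [h0, pow_zero, Nat.dvd_one] at this
    exact absurd this (Nat.one_lt_pow ht.ne' hp).ne'
  have hdvd : p ^ t ∣ w ^ (M + 1) := hM ▸ Nat.find_spec hex
  have hmin : ¬ p ^ t ∣ w ^ M := Nat.find_min hex (by omega)
  have hMt : M + 1 ≤ t := hM ▸ Nat.find_min' hex (pow_dvd_pow_of_dvd hpw t)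
  obtain ⟨s, hs⟩ := hdvd
  have hY : ¬ w ∣ r * s := by
    rintro ⟨z, hz⟩
    apply hmin
    have h1 : w ^ M * r = p ^ t * z := by
      apply Nat.eq_of_mul_eq_mul_left hw
      calc w * (w ^ M * r) = w ^ (M + 1) * r := by ring
        _ = p ^ t * (r * s) := by rw [hs]; ring
        _ = w * (p ^ t * z) := by rw [hz]; ring
    exact (Nat.Coprime.pow_left t hr).dvd_of_dvd_mul_right ⟨z, h1⟩
  refine ⟨M, r * s / w, r * s % w, ?_, Nat.mod_lt _ hw, by omega,
    Nat.le_of_dvd (by positivity) ⟨s, hs⟩, ?_⟩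
  · exact Nat.one_le_iff_ne_zero.2 fun h => hY (Nat.dvd_of_mod_eq_zero h)
  · have hw' : (w : ℝ) ≠ 0 := by exact_mod_cast hw.ne'
    have hp' : (p : ℝ) ≠ 0 := by exact_mod_cast (by omega : p ≠ 0)
    have hsR : (w : ℝ) ^ (M + 1) = (p : ℝ) ^ t * s := by exact_mod_cast hs
    have hdiv : (w : ℝ) * ((r * s / w : ℕ) : ℝ) + ((r * s % w : ℕ) : ℝ) = r * s := by
      exact_mod_cast Nat.div_add_mod (r * s) w
    have h : ((M : ℤ) + 1) = ((M + 1 : ℕ) : ℤ) := by push_cast; ring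
    simp only [childRight, h, zpow_natCast, Int.cast_natCast]
    rw [Nat.cast_add_one, add_sub_cancel_right]
    calc ((r * s / w : ℕ) : ℝ) / (w : ℝ) ^ M + ((r * s % w : ℕ) : ℝ) / (w : ℝ) ^ (M + 1)
        = (w * ((r * s / w : ℕ) : ℝ) + ((r * s % w : ℕ) : ℝ)) / (w : ℝ) ^ (M + 1) := by
          rw [pow_succ]; field_simp
      _ = r / (p : ℝ) ^ t := by
          rw [hdiv, div_eq_div_iff (pow_ne_zero _ hw') (pow_ne_zero _ hp'), hsR]; ring

/-- There are arbitrarily short `v`-adic intervals `I` for which `r / p ^ t` lies slightly to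
the right of `Z(I)`. -/
theorem exists_adicInterval_Zpt_lt {p v t r : ℕ} (hp : 1 < p) (hv : 1 < v)
    (hpv : Nat.Coprime p v) (hpt : p ^ t ≡ 1 [MOD v]) (hr : r ≡ 1 [MOD v]) (L : ℕ) :
    ∃ m k : ℕ, L ≤ m ∧
      (r : ℝ) / (p : ℝ) ^ t - Zpt v m k = r / ((p : ℝ) ^ t * (v : ℝ) ^ (m + 1)) := by
  have hφ : 0 < (p ^ t).totient := Nat.totient_pos.2 (by positivity)
  obtain ⟨m, hm⟩ : ∃ m, (p ^ t).totient * (L + 1) = m + 1 :=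
    Nat.exists_eq_succ_of_ne_zero (by positivity)
  have hLm : L ≤ m := by nlinarith
  have h1 : v ^ (m + 1) ≡ 1 [MOD p ^ t] := by
    rw [← hm, pow_mul]
    simpa using (Nat.ModEq.pow_totient (Nat.Coprime.pow_right t hpv.symm)).pow (L + 1)
  have hvpos : 1 ≤ v ^ (m + 1) := Nat.one_le_pow _ _ (by omega)
  obtain ⟨b, hb⟩ := (Nat.modEq_iff_dvd' hvpos).1 h1.symm
  have hbN : v ^ (m + 1) = p ^ t * b + 1 := by omega
  have hk : v ∣ r * b + 1 := by
    apply (Nat.Coprime.pow_left t hpv).symm.dvd_of_dvd_mul_left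
    rw [← Nat.modEq_zero_iff_dvd]
    have e : p ^ t * (r * b + 1) + r = r * v ^ (m + 1) + p ^ t := by rw [hbN]; ring
    have hz : v ^ (m + 1) ≡ 0 [MOD v] := (Nat.modEq_zero_iff_dvd).2 (dvd_pow_self v (by omega))
    have : p ^ t * (r * b + 1) + r ≡ 0 + r [MOD v] := by
      rw [e]
      exact ((hz.mul_left r).trans (by simp [Nat.ModEq])).add (hpt.trans hr.symm)
    exact Nat.ModEq.add_right_cancel' r this
  obtain ⟨k, hk⟩ := hk
  refine ⟨m, k, hLm, ?_⟩
  have hp' : (p : ℝ) ≠ 0 := by exact_mod_cast (by omega : p ≠ 0)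
  have hv' : (v : ℝ) ≠ 0 := by exact_mod_cast (by omega : v ≠ 0)
  have hbR : (v : ℝ) ^ (m + 1) = (p : ℝ) ^ t * b + 1 := by exact_mod_cast hbN
  have hkR : (r : ℝ) * b + 1 = v * k := by exact_mod_cast hk
  have h : ((m : ℤ) + 1) = ((m + 1 : ℕ) : ℤ) := by push_cast; ring
  have hZ : Zpt v m k = r * b / (v : ℝ) ^ (m + 1) := by
    simp only [Zpt, h, zpow_natCast, Int.cast_natCast]
    rw [eq_sub_of_add_eq hkR, pow_succ]
    field_simp
    ring
  rw [hZ, div_sub_div _ _ (pow_ne_zero _ hp') (pow_ne_zero _ hv')]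
  congr 1
  rw [hbR]
  ring

/-- If `Z(I) < ζ` and `ζ` lies inside the short interval `I`, then the smallest `w`-adic interval
containing `I` is the one having `ζ` as an interior child endpoint. -/
theorem adicInterval_parent_of_childRight {v w m M k y : ℕ} {kI : ℤ} {ζ : ℝ} (hv : 1 < v)
    (hy : 1 ≤ y) (hyw : y < w) (hζ : childRight w M (k + 1 : ℕ) y = ζ)
    (hvw : w ^ (M + 1) ≤ v ^ m) (hZ : Zpt v m kI < ζ) (hζI : ζ < kI / (v : ℝ) ^ m) :
    adicInterval v m kI ⊆ adicInterval w M (k + 1 : ℕ) ∧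
      ∀ m' k' : ℤ, adicInterval v m kI ⊆ adicInterval w m' k' →
        adicInterval w M (k + 1 : ℕ) ⊆ adicInterval w m' k' := by
  have hw0 : 0 < w := by omega
  have hw : (0 : ℝ) < w := by exact_mod_cast hw0
  have hv0 : (1 : ℝ) < v := by exact_mod_cast hv
  have hy' : (1 : ℝ) ≤ y := by exact_mod_cast hy
  have hyw' : (y : ℝ) + 1 ≤ w := by exact_mod_cast hyw
  have hm1 : ((m : ℤ) + 1) = ((m + 1 : ℕ) : ℤ) := by push_cast; ring
  have hM1 : ((M : ℤ) + 1) = ((M + 1 : ℕ) : ℤ) := by push_cast; ring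
  have hζ' : ζ = (k : ℝ) / (w : ℝ) ^ M + y / (w : ℝ) ^ (M + 1) := by
    rw [← hζ]
    simp only [childRight, hM1, zpow_natCast, Int.cast_natCast]
    rw [Nat.cast_add_one, add_sub_cancel_right]
  have hlast : (0 : ℝ) < ((v : ℝ) - 1) / (v : ℝ) ^ (m + 1) :=
    div_pos (by linarith) (by positivity)
  have hZ' : ((kI : ℝ) - 1) / (v : ℝ) ^ m + ((v : ℝ) - 1) / (v : ℝ) ^ (m + 1) < ζ := by
    simpa only [Zpt, hm1, zpow_natCast] using hZ
  have hZI : Zpt v m kI ∈ adicInterval v m kI := by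
    refine ⟨?_, by simpa only [zpow_natCast] using hZ.trans hζI⟩
    simp only [Zpt, hm1, zpow_natCast]
    linarith
  have hζI' : ζ ∈ adicInterval v m kI :=
    ⟨hZI.1.trans hZ.le, by simpa only [zpow_natCast] using hζI⟩
  have hζJ : ζ ∈ adicInterval w M (k + 1 : ℕ) := hζ ▸ childRight_mem_adicInterval hyw
  constructor
  · have hlen : 1 / (v : ℝ) ^ m ≤ 1 / (w : ℝ) ^ (M + 1) :=
      one_div_le_one_div_of_le (by positivity) (by exact_mod_cast hvw)
    have e : (k + 1 : ℝ) / (w : ℝ) ^ M = ζ + (w - y) / (w : ℝ) ^ (M + 1) := by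
      rw [hζ', pow_succ]; field_simp; ring
    have h1 : 1 / (w : ℝ) ^ (M + 1) ≤ (w - y) / (w : ℝ) ^ (M + 1) := by
      gcongr; linarith
    have h2 : 1 / (w : ℝ) ^ (M + 1) ≤ y / (w : ℝ) ^ (M + 1) := by gcongr
    have h3 : ((kI : ℝ) - 1) / (v : ℝ) ^ m = kI / (v : ℝ) ^ m - 1 / (v : ℝ) ^ m := sub_div _ _ _
    simp only [adicInterval, zpow_natCast]
    apply Set.Ico_subset_Ico
    · push_cast
      rw [add_sub_cancel_right]
      linarith
    · push_cast
      linarith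
  · intro m' k' hsub
    refine adicInterval_subset_of_mem hw0 ?_ hζJ (hsub hζI')
    by_contra! hlt
    obtain ⟨d, hd⟩ := Int.le.dest (Int.add_one_le_of_lt hlt)
    have hpow : (w : ℝ) ^ m' = (w : ℝ) ^ (M + 1) * (w : ℝ) ^ d := by
      rw [← hd, zpow_add₀ hw.ne', hM1, zpow_natCast, zpow_natCast]
    have hlow := (hsub hZI).1.trans_lt hZ
    have hupp := (hsub hζI').2
    have hζN : ζ * (w : ℝ) ^ m' = (k * w + y) * w ^ d := by
      rw [hpow, hζ', pow_succ]; field_simp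
    rw [div_lt_iff₀ (zpow_pos hw _), hζN] at hlow
    rw [lt_div_iff₀ (zpow_pos hw _), hζN] at hupp
    have a1 : k' - 1 < (k * w + y) * (w : ℤ) ^ d := by exact_mod_cast hlow
    have a2 : (k * w + y) * (w : ℤ) ^ d < k' := by exact_mod_cast hupp
    omega

/-- The parent interval of `ζ = r / p ^ t` stays within `W / p ^ t` of `ζ`. -/
theorem adicInterval_subset_Ico_of_childRight {p w W t r M k y : ℕ} (hp : 0 < p)
    (hyw : y < w) (hwW : w ≤ W) (hpw : p ^ t ≤ w ^ (M + 1))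
    (hζ : childRight w M (k + 1 : ℕ) y = (r : ℝ) / (p : ℝ) ^ t) :
    adicInterval w M (k + 1 : ℕ) ⊆
      Set.Ico (((r : ℝ) - W) / (p : ℝ) ^ t) (((r : ℝ) + W) / (p : ℝ) ^ t) := by
  have hw : (0 : ℝ) < w := by exact_mod_cast (by omega : 0 < w)
  have hp' : (0 : ℝ) < p := by exact_mod_cast hp
  have hmem := childRight_mem_adicInterval (M := M) (k := k) hyw
  rw [hζ] at hmem
  obtain ⟨h1, h2⟩ := hmem
  have hlen : 1 / (w : ℝ) ^ M ≤ W / (p : ℝ) ^ t := by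
    rw [div_le_div_iff₀ (by positivity) (by positivity), one_mul]
    calc (p : ℝ) ^ t ≤ (w : ℝ) ^ (M + 1) := by exact_mod_cast hpw
      _ = w * (w : ℝ) ^ M := by ring
      _ ≤ W * (w : ℝ) ^ M := by gcongr
  have h3 : ((k + 1 : ℕ) - 1 : ℝ) / (w : ℝ) ^ M = (k + 1 : ℕ) / (w : ℝ) ^ M - 1 / (w : ℝ) ^ M :=
    sub_div _ _ _
  simp only [adicInterval, zpow_natCast, Int.cast_natCast] at h1 h2 ⊢
  apply Set.Ico_subset_Ico
  · rw [sub_div]; linarith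
  · rw [add_div]; linarith

theorem disjoint_Ico_div_pow {p r W : ℕ} (hp : 1 < p) (hrW : 3 * W ≤ r) {t : ℕ → ℕ}
    (ht : StrictMono t) {a b : ℕ} (hab : a ≠ b) :
    Disjoint (Set.Ico (((r : ℝ) - W) / (p : ℝ) ^ t a) (((r : ℝ) + W) / (p : ℝ) ^ t a))
      (Set.Ico (((r : ℝ) - W) / (p : ℝ) ^ t b) (((r : ℝ) + W) / (p : ℝ) ^ t b)) := by
  wlog h : a < b generalizing a b
  · exact (this hab.symm (by omega)).symm
  have hp' : (2 : ℝ) ≤ p := by exact_mod_cast hp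
  have hrW' : 3 * (W : ℝ) ≤ r := by exact_mod_cast hrW
  have hW : (0 : ℝ) ≤ W := by positivity
  have hpow : 2 * (p : ℝ) ^ t a ≤ (p : ℝ) ^ t b := by
    calc 2 * (p : ℝ) ^ t a ≤ p * (p : ℝ) ^ t a := by gcongr
      _ = (p : ℝ) ^ (t a + 1) := by ring
      _ ≤ (p : ℝ) ^ t b := pow_le_pow_right₀ (by linarith) (ht h)
  have hkey : ((r : ℝ) + W) / (p : ℝ) ^ t b ≤ ((r : ℝ) - W) / (p : ℝ) ^ t a := by
    have hpa : (0 : ℝ) < (p : ℝ) ^ t a := by positivity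
    rw [div_le_div_iff₀ (by positivity) hpa]
    calc ((r : ℝ) + W) * (p : ℝ) ^ t a ≤ (2 * (r - W)) * (p : ℝ) ^ t a := by gcongr; linarith
      _ = (r - W) * (2 * (p : ℝ) ^ t a) := by ring
      _ ≤ (r - W) * (p : ℝ) ^ t b := by gcongr; linarith
  rw [Set.disjoint_left]
  rintro x ⟨hx, -⟩ ⟨-, hx'⟩
  linarith

/-- Let `p` be prime, `v > 1` coprime to `p`, `u = p^n > v`, and `c′_1, …, c′_K` positive
integers. Then there is a sequence of `v`-adic intervals `I_ℓ ⊆ [0,1)` with associated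
positive integers `α_ℓ`, such that: (1) for each `i`, the smallest `(u·c′_i)`-adic
intervals `J^i_ℓ ⊇ I_ℓ` are pairwise disjoint and contained in `[0,1)` (in particular the
`I_ℓ` are pairwise disjoint); (2) each value `α` is attained by only finitely many `α_ℓ`;
(3) for each `ℓ, i` there is a point `ζ`, the right endpoint of the `y`-th
`(u·c′_i)`-adic child of `J^i_ℓ` for some `1 ≤ y ≤ u·c′_i − 1`, with
`0 < ζ − Z(I_ℓ) ≤ v^{−100 α_ℓ} |I_ℓ|`. -/
theorem interval_family_selection (p : ℕ) (hp : p.Prime) (v : ℕ) (hv : 1 < v)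
    (hpv : Nat.Coprime p v) (n : ℕ) (hn : 1 ≤ n) (u : ℕ) (hu : u = p ^ n) (hvu : v < u)
    (K : ℕ) (c : Fin K → ℕ) (hc : ∀ i, 0 < c i) :
    ∃ mI kI : ℕ → ℤ, ∃ α : ℕ → ℕ, ∃ mJ kJ : Fin K → ℕ → ℤ,
      (∀ ℓ : ℕ, 0 < α ℓ) ∧
      (∀ ℓ : ℕ, adicInterval v (mI ℓ) (kI ℓ) ⊆ Set.Ico (0 : ℝ) 1) ∧
      (∀ (i : Fin K) (ℓ : ℕ),
        adicInterval v (mI ℓ) (kI ℓ) ⊆ adicInterval (u * c i) (mJ i ℓ) (kJ i ℓ)) ∧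
      (∀ (i : Fin K) (ℓ : ℕ), ∀ m' k' : ℤ,
        adicInterval v (mI ℓ) (kI ℓ) ⊆ adicInterval (u * c i) m' k' →
        adicInterval (u * c i) (mJ i ℓ) (kJ i ℓ) ⊆ adicInterval (u * c i) m' k') ∧
      (∀ (i : Fin K) (ℓ : ℕ),
        adicInterval (u * c i) (mJ i ℓ) (kJ i ℓ) ⊆ Set.Ico (0 : ℝ) 1) ∧
      (∀ (i : Fin K) (ℓ ℓ' : ℕ), ℓ ≠ ℓ' →
        Disjoint (adicInterval (u * c i) (mJ i ℓ) (kJ i ℓ))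
          (adicInterval (u * c i) (mJ i ℓ') (kJ i ℓ'))) ∧
      (∀ ℓ ℓ' : ℕ, ℓ ≠ ℓ' →
        Disjoint (adicInterval v (mI ℓ) (kI ℓ)) (adicInterval v (mI ℓ') (kI ℓ'))) ∧
      (∀ A : ℕ, {ℓ : ℕ | α ℓ = A}.Finite) ∧
      (∀ (i : Fin K) (ℓ : ℕ), ∃ y : ℕ, 1 ≤ y ∧ y ≤ u * c i - 1 ∧
        0 < childRight (u * c i) (mJ i ℓ) (kJ i ℓ) y - Zpt v (mI ℓ) (kI ℓ) ∧
        childRight (u * c i) (mJ i ℓ) (kJ i ℓ) y - Zpt v (mI ℓ) (kI ℓ) ≤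
          ((v : ℝ) ^ (100 * α ℓ))⁻¹ * ((v : ℝ) ^ (mI ℓ))⁻¹) := by
  have hp1 : 1 < p := hp.one_lt
  have hp' : (0 : ℝ) < p := by exact_mod_cast hp.pos
  have hv' : (0 : ℝ) < v := by exact_mod_cast (by omega : 0 < v)
  have hu0 : 0 < u := by omega
  have hpu : p ∣ u := hu ▸ dvd_pow_self p (by omega)
  obtain ⟨W, hW⟩ : ∃ W, W = u * (1 + ∑ i, c i) := ⟨_, rfl⟩
  obtain ⟨r, hr⟩ : ∃ r, r = p * v * (3 * W) + 1 := ⟨_, rfl⟩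
  obtain ⟨t, ht⟩ : ∃ t : ℕ → ℕ, t = fun ℓ => v.totient * ((100 * n + r) * (ℓ + 1)) := ⟨_, rfl⟩
  have hφ : 0 < v.totient := Nat.totient_pos.2 (by omega)
  have hr0 : 0 < r := by omega
  have htm : StrictMono t := by
    rw [ht]
    intro a b hab
    have : 0 < 100 * n + r := by omega
    dsimp only
    gcongr
  have ht0 : ∀ ℓ, 0 < t ℓ := fun ℓ => by rw [ht]; positivity
  have hcW : ∀ i, u * c i ≤ W := fun i => by
    rw [hW]
    gcongr
    exact (Finset.single_le_sum (fun _ _ => Nat.zero_le _) (Finset.mem_univ i)).trans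
      (Nat.le_add_left _ _)
  have hpW : p ≤ W := by
    rw [hW]
    exact (Nat.le_of_dvd hu0 hpu).trans (Nat.le_mul_of_pos_right _ (by omega))
  have hrp : Nat.Coprime p r := by
    rw [hr, mul_assoc]
    simp
  have hrv : r ≡ 1 [MOD v] := by
    rw [hr, mul_comm p v, mul_assoc]
    simp [Nat.ModEq]
  have h3W : 3 * W ≤ r := by
    rw [hr]
    have : 1 * (3 * W) ≤ p * v * (3 * W) := by
      gcongr
      exact Nat.one_le_iff_ne_zero.2 (by positivity)
    omega
  have hptv : ∀ ℓ, p ^ t ℓ ≡ 1 [MOD v] := fun ℓ => by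
    simp only [ht, pow_mul p v.totient]
    simpa using (Nat.ModEq.pow_totient hpv).pow ((100 * n + r) * (ℓ + 1))
  have hbig : ∀ ℓ, r * v ^ (100 * (ℓ + 1)) < p ^ t ℓ := fun ℓ => by
    calc r * v ^ (100 * (ℓ + 1)) < p ^ r * v ^ (100 * (ℓ + 1)) := by
          gcongr; exact Nat.lt_pow_self hp1
      _ ≤ p ^ (r * (ℓ + 1)) * (p ^ n) ^ (100 * (ℓ + 1)) := by
          gcongr
          · exact hp.one_le
          · exact Nat.le_mul_of_pos_right _ (by omega)
          · exact hu ▸ hvu.le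
      _ = p ^ ((100 * n + r) * (ℓ + 1)) := by rw [← pow_mul, ← pow_add]; congr 1; ring
      _ ≤ p ^ t ℓ := by
          rw [ht]
          exact Nat.pow_le_pow_right hp.pos (Nat.le_mul_of_pos_left _ hφ)
  have hI := fun ℓ => exists_adicInterval_Zpt_lt hp1 hv hpv (hptv ℓ) hrv (W * t ℓ)
  choose m k hm hZ using hI
  have hZlt : ∀ ℓ, Zpt v (m ℓ) (k ℓ) < (r : ℝ) / (p : ℝ) ^ t ℓ := fun ℓ => by
    rw [← sub_pos, hZ]; positivity
  have hIlt : ∀ ℓ, (r : ℝ) / (p : ℝ) ^ t ℓ < ((k ℓ : ℤ) : ℝ) / (v : ℝ) ^ m ℓ := fun ℓ => by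
    have hlt : (r : ℝ) < (p : ℝ) ^ t ℓ := by
      exact_mod_cast (Nat.le_mul_of_pos_right r (by positivity)).trans_lt (hbig ℓ)
    have h1 : (r : ℝ) / ((p : ℝ) ^ t ℓ * (v : ℝ) ^ (m ℓ + 1)) < 1 / (v : ℝ) ^ (m ℓ + 1) := by
      rw [← div_div]
      gcongr
      rwa [div_lt_one (by positivity)]
    have h2 : Zpt v (m ℓ) (k ℓ) + 1 / (v : ℝ) ^ (m ℓ + 1) = (k ℓ : ℝ) / (v : ℝ) ^ m ℓ := by
      have e : ((m ℓ : ℤ) + 1) = ((m ℓ + 1 : ℕ) : ℤ) := by push_cast; ring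
      simp only [Zpt, e, zpow_natCast, Int.cast_natCast]
      rw [pow_succ]
      field_simp
      ring
    have h3 := hZ ℓ
    rw [Int.cast_natCast]
    linarith
  have parent : ∀ w, p ∣ w → 0 < w → w ≤ W → ∀ ℓ, ∃ M k' y : ℕ,
      (1 ≤ y ∧ y ≤ w - 1) ∧ childRight w M (k' + 1 : ℕ) y = (r : ℝ) / (p : ℝ) ^ t ℓ ∧
      adicInterval v (m ℓ) (k ℓ) ⊆ adicInterval w M (k' + 1 : ℕ) ∧
      (∀ m' k'' : ℤ, adicInterval v (m ℓ) (k ℓ) ⊆ adicInterval w m' k'' →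
        adicInterval w M (k' + 1 : ℕ) ⊆ adicInterval w m' k'') ∧
      adicInterval w M (k' + 1 : ℕ) ⊆ Set.Ico 0 1 ∧
      adicInterval w M (k' + 1 : ℕ) ⊆
        Set.Ico (((r : ℝ) - W) / (p : ℝ) ^ t ℓ) (((r : ℝ) + W) / (p : ℝ) ^ t ℓ) := by
    intro w hpw hw hwW ℓ
    obtain ⟨M, k', y, hy, hyw, hMt, hpM, hζ⟩ := exists_childRight_eq hp1 hpw hw (ht0 ℓ) hrp
    have hlen : w ^ (M + 1) ≤ v ^ m ℓ := by
      calc w ^ (M + 1) ≤ w ^ t ℓ := Nat.pow_le_pow_right hw hMt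
        _ ≤ (v ^ W) ^ t ℓ := by gcongr; exact hwW.trans (Nat.lt_pow_self hv).le
        _ ≤ v ^ m ℓ := by rw [← pow_mul]; exact Nat.pow_le_pow_right (by omega) (hm ℓ)
    obtain ⟨hsub, hmin⟩ :=
      adicInterval_parent_of_childRight hv hy hyw hζ hlen (hZlt ℓ) (hIlt ℓ)
    refine ⟨M, k', y, ⟨hy, by omega⟩, hζ, hsub, hmin, ?_,
      adicInterval_subset_Ico_of_childRight hp.pos hyw hwW hpM hζ⟩
    rw [← adicInterval_zero_one w]
    refine adicInterval_subset_of_mem hw (Int.natCast_nonneg M)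
      (hζ ▸ childRight_mem_adicInterval hyw) ?_
    rw [adicInterval_zero_one]
    refine ⟨by positivity, ?_⟩
    rw [div_lt_one (by positivity)]
    exact_mod_cast (Nat.le_mul_of_pos_right r (by positivity)).trans_lt (hbig ℓ)
  have hJ := fun i => parent (u * c i) (hpu.mul_right _) (Nat.mul_pos hu0 (hc i)) (hcW i)
  choose M k' y hy hζ hsub hmin h01 hloc using hJ
  refine ⟨fun ℓ => m ℓ, fun ℓ => k ℓ, fun ℓ => ℓ + 1, fun i ℓ => M i ℓ,
    fun i ℓ => (k' i ℓ + 1 : ℕ), fun ℓ => Nat.succ_pos ℓ, fun ℓ => ?_, hsub, hmin, h01,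
    fun i ℓ ℓ' hne => (disjoint_Ico_div_pow hp1 h3W htm hne).mono (hloc i ℓ) (hloc i ℓ'),
    fun ℓ ℓ' hne => ?_, fun A => ?_, fun i ℓ => ⟨y i ℓ, (hy i ℓ).1, (hy i ℓ).2, ?_, ?_⟩⟩
  · obtain ⟨_, _, _, -, -, h, -, h', -⟩ := parent p dvd_rfl hp.pos hpW ℓ
    exact h.trans h'
  · obtain ⟨_, _, _, -, -, h₁, -, -, h₁'⟩ := parent p dvd_rfl hp.pos hpW ℓ
    obtain ⟨_, _, _, -, -, h₂, -, -, h₂'⟩ := parent p dvd_rfl hp.pos hpW ℓ'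
    exact (disjoint_Ico_div_pow hp1 h3W htm hne).mono (h₁.trans h₁') (h₂.trans h₂')
  · exact Set.Finite.preimage (Set.injOn_of_injective (add_left_injective 1))
      (Set.finite_singleton A)
  · rw [hζ, sub_pos]
    exact hZlt ℓ
  · rw [hζ, hZ, zpow_natCast, ← mul_inv, inv_eq_one_div,
      div_le_div_iff₀ (by positivity) (by positivity), one_mul]
    have h1 : (r : ℝ) * (v : ℝ) ^ (100 * (ℓ + 1)) ≤ (p : ℝ) ^ t ℓ := by
      exact_mod_cast (hbig ℓ).le
    calc (r : ℝ) * ((v : ℝ) ^ (100 * (ℓ + 1)) * (v : ℝ) ^ m ℓ)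
        = r * (v : ℝ) ^ (100 * (ℓ + 1)) * (v : ℝ) ^ m ℓ := by ring
      _ ≤ (p : ℝ) ^ t ℓ * (v : ℝ) ^ (m ℓ + 1) := by
          gcongr
          · exact_mod_cast hv.le
          · omega
end

section
/- Let p be a prime, let v > 1 be an integer coprime to p, let n ≥ 1 be such that u = p^n > v, and let c′_1, …, c′_k be positive integers. Given any interval J̃ ⊆ [0,1] of positive length and any ε > 0, there exists a v-adic interval I ⊆ J̃ such that for every 1 ≤ i ≤ k, letting J^i be the smallest (u·c′_i)-adic interval containing I, there is a point ζ_i which is the right endpoint of the y-th (u·c′_i)-adic child of J^i for some 1 ≤ y ≤ u·c′_i − 1, satisfying 0 < ζ_i − Z(I) ≤ ε·|I|. -/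
open MeasureTheory

lemma adicInterval_subset_of_le_of_mem {b : ℕ} (hb : 2 ≤ b) {m m' k k' : ℤ} (hm : m' ≤ m) {x : ℝ}
    (hx : x ∈ adicInterval b m k) (hx' : x ∈ adicInterval b m' k') :
    adicInterval b m k ⊆ adicInterval b m' k' := by
  have hb0 : (0 : ℝ) < b := by positivity
  obtain ⟨d, rfl⟩ := Int.le.dest hm
  have hpow : (b : ℝ) ^ (m' + (d : ℤ)) = (b : ℝ) ^ m' * (b : ℝ) ^ d := by
    rw [zpow_add₀ hb0.ne', zpow_natCast]
  have hB : (0 : ℝ) < (b : ℝ) ^ m' := by positivity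
  have hD : (0 : ℝ) < (b : ℝ) ^ d := by positivity
  simp only [adicInterval, Set.mem_Ico, hpow] at hx hx' ⊢
  rw [div_le_iff₀ (by positivity), lt_div_iff₀ (by positivity)] at hx
  rw [div_le_iff₀ (by positivity), lt_div_iff₀ (by positivity)] at hx'
  have h1 : (k' - 1) * (b : ℤ) ^ d < k := by
    have : ((k' : ℝ) - 1) * (b : ℝ) ^ d < k := by nlinarith
    exact_mod_cast this
  have h2 : k - 1 < k' * (b : ℤ) ^ d := by
    have : (k : ℝ) - 1 < k' * (b : ℝ) ^ d := by nlinarith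
    exact_mod_cast this
  have h1' : ((k' : ℝ) - 1) * (b : ℝ) ^ d ≤ k - 1 := by exact_mod_cast Int.le_sub_one_of_lt h1
  have h2' : (k : ℝ) ≤ k' * (b : ℝ) ^ d := by exact_mod_cast (by omega : k ≤ k' * (b : ℤ) ^ d)
  apply Set.Ico_subset_Ico
  · rw [div_le_div_iff₀ hB (by positivity)]
    nlinarith
  · rw [div_le_div_iff₀ (by positivity) hB]
    nlinarith

/-- Every sufficiently short interval around a non-integral point `ζ` of a `b`-adic grid has the
same smallest `b`-adic interval containing it, and `ζ` separates two children of that interval. -/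
lemma exists_smallest_adicInterval {b : ℕ} (hb : 2 ≤ b) {ζ : ℝ} (hζ : ∀ a : ℤ, ζ ≠ a) {N : ℕ}
    (hN : ∃ a : ℤ, (b : ℝ) ^ N * ζ = a) :
    ∃ mJ kJ : ℤ, ∃ ρ : ℝ, 0 < ρ ∧
      (∃ y : ℕ, 1 ≤ y ∧ y ≤ b - 1 ∧ childRight b mJ kJ y = ζ) ∧
      ∀ l r : ℝ, l < ζ → ζ < r → r - l < ρ →
        Set.Ico l r ⊆ adicInterval b mJ kJ ∧
        ∀ m' k' : ℤ, Set.Ico l r ⊆ adicInterval b m' k' →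
          adicInterval b mJ kJ ⊆ adicInterval b m' k' := by
  classical
  have hb0 : (0 : ℝ) < b := by positivity
  have hex : ∃ N : ℕ, ∃ a : ℤ, (b : ℝ) ^ N * ζ = a := ⟨N, hN⟩
  obtain ⟨M, ⟨a, ha⟩, hmin⟩ : ∃ M : ℕ, (∃ a : ℤ, (b : ℝ) ^ (M + 1) * ζ = a) ∧
      ∀ a : ℤ, (b : ℝ) ^ M * ζ ≠ a := by
    have hne : Nat.find hex ≠ 0 := fun h0 => by
      obtain ⟨a, ha⟩ := Nat.find_spec hex
      rw [h0] at ha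
      exact hζ a (by simpa using ha)
    obtain ⟨M, hM⟩ := Nat.exists_eq_succ_of_ne_zero hne
    exact ⟨M, by simpa only [hM] using Nat.find_spec hex, fun a ha => Nat.find_min hex (by omega : M < _) ⟨a, ha⟩⟩
  set f : ℤ := ⌊(b : ℝ) ^ M * ζ⌋ with hf
  have hBM : (0 : ℝ) < (b : ℝ) ^ M := by positivity
  have hf1 : (f : ℝ) < (b : ℝ) ^ M * ζ := lt_of_le_of_ne (Int.floor_le _) (hmin f).symm
  have hf2 : (b : ℝ) ^ M * ζ < f + 1 := Int.lt_floor_add_one _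
  have hL : (f : ℝ) / (b : ℝ) ^ M < ζ := by rw [div_lt_iff₀ hBM]; linarith
  have hR : ζ < ((f : ℝ) + 1) / (b : ℝ) ^ M := by rw [lt_div_iff₀ hBM]; linarith
  have hJ : adicInterval b (M : ℤ) (f + 1) =
      Set.Ico ((f : ℝ) / (b : ℝ) ^ M) (((f : ℝ) + 1) / (b : ℝ) ^ M) := by
    simp [adicInterval]
  refine ⟨M, f + 1, min (ζ - (f : ℝ) / (b : ℝ) ^ M) (((f : ℝ) + 1) / (b : ℝ) ^ M - ζ),
    lt_min (by linarith) (by linarith), ?_, ?_⟩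
  · have haR : (a : ℝ) = b * ((b : ℝ) ^ M * ζ) := by rw [← ha]; ring
    have h1 : (b : ℤ) * f < a := by
      have : (b : ℝ) * f < a := by rw [haR]; gcongr
      exact_mod_cast this
    have h2 : a < (b : ℤ) * f + b := by
      have : (a : ℝ) < b * f + b := by rw [haR]; nlinarith
      exact_mod_cast this
    obtain ⟨y, hy⟩ := Int.eq_ofNat_of_zero_le (by omega : 0 ≤ a - (b : ℤ) * f)
    refine ⟨y, by omega, by omega, ?_⟩
    have hyR : (y : ℝ) = a - b * f := by
      have : ((y : ℤ) : ℝ) = ((a - (b : ℤ) * f : ℤ) : ℝ) := by rw [hy]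
      exact_mod_cast this
    have hz : (b : ℝ) ^ ((M : ℤ) + 1) = (b : ℝ) ^ M * b := by
      rw [zpow_add₀ hb0.ne', zpow_natCast, zpow_one]
    rw [childRight, hz, hyR, haR, zpow_natCast]
    push_cast
    field_simp
    ring
  · intro l r hl hr hlr
    have hρ := lt_min_iff.mp hlr
    have hsub : Set.Ico l r ⊆ adicInterval b (M : ℤ) (f + 1) := by
      rw [hJ]
      exact Set.Ico_subset_Ico (by linarith) (by linarith)
    refine ⟨hsub, fun m' k' h => ?_⟩
    have hmem : ζ ∈ Set.Ico l r := ⟨hl.le, hr⟩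
    refine adicInterval_subset_of_le_of_mem hb ?_ (hsub hmem) (h hmem)
    by_contra! hlt
    obtain ⟨d, hd⟩ := Int.le.dest (show (M : ℤ) + 1 ≤ m' by omega)
    have hpow : (b : ℝ) ^ m' = (b : ℝ) ^ (M + 1) * (b : ℝ) ^ d := by
      rw [← hd, zpow_add₀ hb0.ne', zpow_natCast]
      norm_cast
    have hgrid : (b : ℝ) ^ m' * ζ = ((a * (b : ℤ) ^ d : ℤ) : ℝ) := by
      rw [hpow]; push_cast; rw [← ha]; ring
    have hpos : (0 : ℝ) < (b : ℝ) ^ m' := by positivity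
    have hl' := h ⟨le_refl l, hl.trans hr⟩
    have hζ' := h hmem
    rw [adicInterval, Set.mem_Ico, div_le_iff₀ hpos] at hl'
    rw [adicInterval, Set.mem_Ico, lt_div_iff₀ hpos, mul_comm, hgrid] at hζ'
    have h3 : a * (b : ℤ) ^ d ≤ k' - 1 := Int.le_sub_one_of_lt (by exact_mod_cast hζ'.2)
    have h4 : ((a * (b : ℤ) ^ d : ℤ) : ℝ) ≤ k' - 1 := by exact_mod_cast h3
    rw [← hgrid] at h4
    nlinarith

lemma exists_int_div_pow_mem_Ioo {p : ℕ} (hp : 1 < p) {A B : ℝ} (h : A < B) :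
    ∃ (N : ℕ) (a : ℤ), A < a / (p : ℝ) ^ N ∧ a / (p : ℝ) ^ N < B := by
  have hp' : (1 : ℝ) < p := by exact_mod_cast hp
  obtain ⟨N, hN⟩ := pow_unbounded_of_one_lt (1 / (B - A)) hp'
  rw [div_lt_iff₀ (by linarith)] at hN
  have hP : (0 : ℝ) < (p : ℝ) ^ N := by positivity
  refine ⟨N, ⌊(p : ℝ) ^ N * A⌋ + 1, ?_, ?_⟩
  · rw [lt_div_iff₀ hP]; push_cast; linarith [Int.lt_floor_add_one ((p : ℝ) ^ N * A)]
  · rw [div_lt_iff₀ hP]; push_cast; linarith [Int.floor_le ((p : ℝ) ^ N * A)]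

/-- Let `p` be prime, `v > 1` coprime to `p`, `u = p^n > v`, and `c′_1, …, c′_K` positive
integers. Given any interval `J̃ ⊆ [0,1]` of positive length and any `ε > 0`, there
exists a `v`-adic interval `I ⊆ J̃` such that for every `i`, letting `J^i` be the
smallest `(u·c′_i)`-adic interval containing `I`, there is a point `ζ_i`, the right
endpoint of the `y`-th `(u·c′_i)`-adic child of `J^i` for some `1 ≤ y ≤ u·c′_i − 1`,
with `0 < ζ_i − Z(I) ≤ ε·|I|`. -/
theorem interval_selection_multiple_bases (p : ℕ) (hp : p.Prime) (v : ℕ) (hv : 1 < v)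
    (hpv : Nat.Coprime p v) (n : ℕ) (hn : 1 ≤ n) (u : ℕ) (hu : u = p ^ n) (hvu : v < u)
    (K : ℕ) (c : Fin K → ℕ) (hc : ∀ i, 0 < c i)
    (Jt : Set ℝ) (hJt : Jt ⊆ Set.Icc 0 1) (hconn : Jt.OrdConnected)
    (hpos : ∃ x ∈ Jt, ∃ y ∈ Jt, x < y) (ε : ℝ) (hε : 0 < ε) :
    ∃ mI kI : ℤ, adicInterval v mI kI ⊆ Jt ∧
      ∀ i : Fin K, ∃ mJ kJ : ℤ,
        adicInterval v mI kI ⊆ adicInterval (u * c i) mJ kJ ∧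
        (∀ m' k' : ℤ, adicInterval v mI kI ⊆ adicInterval (u * c i) m' k' →
          adicInterval (u * c i) mJ kJ ⊆ adicInterval (u * c i) m' k') ∧
        ∃ y : ℕ, 1 ≤ y ∧ y ≤ u * c i - 1 ∧
          0 < childRight (u * c i) mJ kJ y - Zpt v mI kI ∧
          childRight (u * c i) mJ kJ y - Zpt v mI kI ≤ ε * ((v : ℝ) ^ mI)⁻¹ := by
  have hv' : (1 : ℝ) < v := by exact_mod_cast hv
  have hv0 : (0 : ℝ) < v := by linarith
  obtain ⟨x, hx, y, hy, hxy⟩ := hpos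
  obtain ⟨m₀, hm₀⟩ := pow_unbounded_of_one_lt (2 / (y - x)) hv'
  rw [div_lt_iff₀ (by linarith)] at hm₀
  have hV : (0 : ℝ) < (v : ℝ) ^ m₀ := by positivity
  set q : ℤ := ⌊(v : ℝ) ^ m₀ * x⌋ + 1 with hq
  have hq1 : (v : ℝ) ^ m₀ * x < q := by
    rw [hq]; push_cast; exact Int.lt_floor_add_one _
  have hq2 : (q : ℝ) + 1 < (v : ℝ) ^ m₀ * y := by
    rw [hq]; push_cast; linarith [Int.floor_le ((v : ℝ) ^ m₀ * x)]
  have hδ : 0 < min ε (1 / v) := lt_min hε (by positivity)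
  obtain ⟨N, a, hA, hB⟩ := exists_int_div_pow_mem_Ioo hp.one_lt
    (show ((q : ℝ) + (1 - 1 / v)) / (v : ℝ) ^ m₀ <
      ((q : ℝ) + (1 - 1 / v) + min ε (1 / v)) / (v : ℝ) ^ m₀ from div_lt_div_of_pos_right (by linarith) hV)
  have hP : (0 : ℝ) < (p : ℝ) ^ N := by have := hp.pos; positivity
  set ζ : ℝ := a / (p : ℝ) ^ N with hζdef
  have hpζ : (p : ℝ) ^ N * ζ = a := by rw [hζdef]; field_simp
  rw [div_lt_iff₀ hV] at hA
  rw [lt_div_iff₀ hV] at hB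
  have hδε : min ε (1 / (v : ℝ)) ≤ ε := min_le_left _ _
  have hδv : min ε (1 / (v : ℝ)) ≤ 1 / v := min_le_right _ _
  have hv1 : 1 / (v : ℝ) < 1 := by rw [div_lt_one hv0]; exact hv'
  have hxζ : x < ζ := by nlinarith
  have hζy : ζ < y := by nlinarith
  have hζint : ∀ a : ℤ, ζ ≠ a := by
    intro z hz
    have h0 : (0 : ℝ) < z := by linarith [(hJt hx).1]
    have h1 : (z : ℝ) < 1 := by linarith [(hJt hy).2]
    norm_cast at h0 h1
    omega
  have hgrid : ∀ i, ∃ z : ℤ, ((u * c i : ℕ) : ℝ) ^ N * ζ = z := fun i => by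
    obtain ⟨w, hw⟩ : p ∣ u * c i := hu ▸ (dvd_pow_self p (by omega)).mul_right _
    refine ⟨(w : ℤ) ^ N * a, ?_⟩
    rw [hw]; push_cast; rw [← hpζ]; ring
  choose mJ kJ ρ hρ hchild hsmall using fun i => exists_smallest_adicInterval
    (hv.trans (hvu.trans_le (Nat.le_mul_of_pos_right u (hc i)))) hζint (hgrid i)
  have hφ : 0 < Nat.totient (p ^ N) := Nat.totient_pos.mpr (pow_pos hp.pos N)
  have hlim : Filter.Tendsto (fun s : ℕ => ((v : ℝ) ^ (m₀ + Nat.totient (p ^ N) * s))⁻¹)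
      Filter.atTop (nhds 0) := by
    refine Filter.Tendsto.inv_tendsto_atTop ((tendsto_pow_atTop_atTop_of_one_lt hv').comp ?_)
    exact Filter.tendsto_atTop_mono
      (fun s => (Nat.le_mul_of_pos_left s hφ).trans (Nat.le_add_left _ _)) Filter.tendsto_id
  obtain ⟨s, hsx, hsy, hsρ⟩ := ((hlim.eventually_lt_const (sub_pos.mpr hxζ)).and
    ((hlim.eventually_lt_const (sub_pos.mpr hζy)).and
      (Filter.eventually_all.mpr fun i => hlim.eventually_lt_const (hρ i)))).exists
  set T := Nat.totient (p ^ N) * s with hT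
  have hW : (0 : ℝ) < (v : ℝ) ^ (m₀ + T) := by positivity
  obtain ⟨g, hg⟩ : ∃ g : ℤ, (v : ℝ) ^ (m₀ + T) * ζ = (v : ℝ) ^ m₀ * ζ + g := by
    have hmod : v ^ T ≡ 1 [MOD p ^ N] := by
      have := (Nat.ModEq.pow_totient (hpv.symm.pow_right N)).pow s
      rwa [one_pow, ← pow_mul] at this
    obtain ⟨e, he⟩ := (Nat.modEq_iff_dvd.mp hmod.symm)
    refine ⟨(v : ℤ) ^ m₀ * e * a, ?_⟩
    have heR : (v : ℝ) ^ T - 1 = (p : ℝ) ^ N * e := by exact_mod_cast he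
    push_cast
    rw [← hpζ, pow_add]
    linear_combination (v : ℝ) ^ m₀ * ζ * heR
  set W := (v : ℝ) ^ (m₀ + T) with hWdef
  have hI : adicInterval v ((m₀ + T : ℕ) : ℤ) (q + g + 1) =
      Set.Ico ((q + g : ℝ) / W) ((q + g + 1 : ℝ) / W) := by
    simp only [adicInterval, zpow_natCast, hWdef]
    push_cast
    simp
  have hZ : Zpt v ((m₀ + T : ℕ) : ℤ) (q + g + 1) = ((q : ℝ) + g + (1 - 1 / v)) / W := by
    rw [Zpt, zpow_add₀ hv0.ne', zpow_natCast, zpow_one, ← hWdef]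
    push_cast
    field_simp
    ring
  have hl : (q + g : ℝ) / W < ζ := by rw [div_lt_iff₀ hW]; linarith
  have hr : ζ < (q + g + 1 : ℝ) / W := by rw [lt_div_iff₀ hW]; linarith
  have hlen : (q + g + 1 : ℝ) / W - (q + g : ℝ) / W = W⁻¹ := by field_simp; ring
  refine ⟨((m₀ + T : ℕ) : ℤ), q + g + 1, ?_, fun i => ?_⟩
  · rw [hI]
    exact fun t ht => hconn.out hx hy ⟨by linarith [ht.1], by linarith [ht.2]⟩
  · obtain ⟨h1, h2⟩ := hsmall i _ _ hl hr (hlen ▸ hsρ i)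
    obtain ⟨j, hj1, hj2, hj⟩ := hchild i
    rw [← hI] at h1 h2
    refine ⟨mJ i, kJ i, h1, h2, j, hj1, hj2, ?_, ?_⟩
    · rw [hj, hZ, sub_pos, div_lt_iff₀ hW]
      linarith
    · rw [hj, hZ, zpow_natCast, ← hWdef, sub_le_iff_le_add, ← div_eq_mul_inv, ← add_div,
        le_div_iff₀ hW]
      linarith
end

section
/- Let n_1, …, n_k be integers with each n_i ≥ 2, and let ε > 0. Then there exist infinitely many positive integers x such that for every 1 ≤ i ≤ k, |1/2^x − 1/n_i^{[x·log_{n_i} 2]}| < ε/2^x, where [t] denotes the nearest integer to t (rounding) and log_{n_i} 2 = (log 2)/(log n_i). -/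
/-- Simultaneous homogeneous Diophantine approximation with arbitrarily large denominators. -/
theorem exists_nat_gt_forall_abs_sub_round_lt {ι : Type*} [Fintype ι] (θ : ι → ℝ) {δ : ℝ}
    (hδ : 0 < δ) (N : ℕ) :
    ∃ x : ℕ, N < x ∧ ∀ i, |(x : ℝ) * θ i - round ((x : ℝ) * θ i)| < δ := by
  let v : ℕ → ι → ℝ := fun m i => Int.fract ((m : ℝ) * θ i)
  have hv : ∀ m, v m ∈ Set.Icc (0 : ι → ℝ) 1 := fun m =>
    ⟨fun i => Int.fract_nonneg _, fun i => (Int.fract_lt_one _).le⟩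
  obtain ⟨_, _, φ, hφ, hlim⟩ := isCompact_Icc.tendsto_subseq hv
  obtain ⟨M, hM⟩ := Metric.cauchySeq_iff.1 hlim.cauchySeq δ hδ
  have hgap : φ M + (N + 1) ≤ φ (M + (N + 1)) := by
    simpa [add_comm] using hφ.add_le_nat (N + 1) M
  refine ⟨φ (M + (N + 1)) - φ M, by omega, fun i => ?_⟩
  have hd := (dist_le_pi_dist _ _ i).trans_lt (hM (M + (N + 1)) (by omega) M le_rfl)
  rw [Real.dist_eq] at hd
  refine (round_le _
    (⌊(φ (M + (N + 1)) : ℝ) * θ i⌋ - ⌊(φ M : ℝ) * θ i⌋)).trans_lt (lt_of_eq_of_lt ?_ hd)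
  rw [Nat.cast_sub (by omega)]
  simp only [v, Function.comp, Int.fract]
  push_cast
  ring_nf

theorem one_div_zpow_eq_exp_mul {a b : ℝ} (ha : 0 < a) (hb : 1 < b) (x : ℕ) (r : ℤ) :
    1 / b ^ r = Real.exp (Real.log b * (x * (Real.log a / Real.log b) - r)) * (1 / a ^ x) := by
  have hlog : Real.log b ≠ 0 := (Real.log_pos hb).ne'
  have hb0 : 0 < b := zero_lt_one.trans hb
  have hexp : Real.log b * (x * (Real.log a / Real.log b) - r) =
      Real.log (a ^ x) - Real.log (b ^ r) := by
    rw [Real.log_pow, Real.log_zpow]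
    field_simp
  rw [hexp, Real.exp_sub, Real.exp_log (by positivity), Real.exp_log (by positivity)]
  field_simp


/-- Let `n₁, …, n_K` be integers `≥ 2` and `ε > 0`. Then there exist infinitely many
positive integers `x` such that for every `i`,
`|1/2^x − 1/n_i^{[x·log_{n_i} 2]}| < ε/2^x`, where `[t]` is the nearest integer to `t`
and `log_{n} 2 = log 2 / log n`. -/
theorem simultaneous_closeness (K : ℕ) (n : Fin K → ℕ) (hn : ∀ i, 2 ≤ n i)
    (ε : ℝ) (hε : 0 < ε) :
    ∀ N : ℕ, ∃ x : ℕ, N < x ∧ ∀ i : Fin K,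
      |1 / (2 : ℝ) ^ x -
          1 / (n i : ℝ) ^ round ((x : ℝ) * (Real.log 2 / Real.log (n i)))| <
        ε / (2 : ℝ) ^ x := by
  intro N
  have hev : ∀ᶠ d : ℝ in nhds 0, ∀ i, |1 - Real.exp (Real.log (n i) * d)| < ε := by
    refine Filter.eventually_all.2 fun i => ?_
    have hc : Continuous fun d : ℝ => |1 - Real.exp (Real.log (n i) * d)| := by fun_prop
    exact hc.continuousAt.eventually_lt continuousAt_const (by simpa using hε)
  obtain ⟨δ, hδ, hball⟩ := Metric.eventually_nhds_iff.1 hev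
  obtain ⟨x, hNx, hx⟩ := exists_nat_gt_forall_abs_sub_round_lt
    (fun i => Real.log 2 / Real.log (n i)) hδ N
  refine ⟨x, hNx, fun i => ?_⟩
  have hni : (1 : ℝ) < n i := by exact_mod_cast hn i
  have hlt := hball (by simpa [Real.dist_eq] using hx i) i
  rw [one_div_zpow_eq_exp_mul two_pos hni x, ← one_sub_mul, abs_mul,
    abs_of_pos (a := 1 / (2 : ℝ) ^ x) (by positivity), div_eq_mul_one_div ε]
  exact mul_lt_mul_of_pos_right hlt (by positivity)
end

section
/- Let θ_1, …, θ_k be real numbers and let 1 ≤ j ≤ k. Suppose that 1, θ_1, …, θ_j are linearly independent over ℚ, and that for each ℓ with j < ℓ ≤ k there are rational numbers r_{ℓ,1}, …, r_{ℓ,j} with θ_ℓ = Σ_{i=1}^{j} r_{ℓ,i}·θ_i. Let V = {x ∈ ℝ^k : x_ℓ = Σ_{i=1}^{j} r_{ℓ,i}·x_i for all j < ℓ ≤ k}, a linear subspace of ℝ^k, and let π : ℝ^k → 𝕋^k = (ℝ/ℤ)^k be the quotient map. Then the orbit {π(x·(θ_1,…,θ_k)) : x ∈ ℤ} is contained in π(V)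 and is dense in π(V); that is, π(V) is contained in the closure of the orbit. -/
open MeasureTheory in
/-- A finite invariant measure integrates a multiplicative function to zero as soon as the
function is nontrivial at the translation. -/
theorem integral_eq_zero_of_map_add_left {G : Type*} [AddGroup G] [MeasurableSpace G]
    [MeasurableAdd G] {μ : Measure G} {a : G} (hμ : μ.map (a + ·) = μ)
    {f : G → ℂ} (hf : ∀ x, f (a + x) = f a * f x) (ha : f a ≠ 1) : ∫ x, f x ∂μ = 0 := by
  have h : ∫ x, f x ∂μ = f a * ∫ x, f x ∂μ := by
    conv_lhs => rw [← hμ, (measurableEmbedding_addLeft a).integral_map]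
    simp_rw [hf, integral_const_mul]
  have h' : (f a - 1) * ∫ x, f x ∂μ = 0 := by linear_combination -h
  exact (mul_eq_zero.mp h').resolve_left (sub_ne_zero.mpr ha)

namespace UnitAddTorus

open MeasureTheory

variable {d : Type*} [Fintype d]

theorem mFourier_apply_add (n : d → ℤ) (x y : UnitAddTorus d) :
    mFourier n (x + y) = mFourier n x * mFourier n y := by
  simp [mFourier, fourier_apply, AddCircle.toCircle_add, Finset.prod_mul_distrib]

theorem mFourier_coe_eq_one_iff (n : d → ℤ) (a : d → ℝ) :
    mFourier n (fun i => (a i : UnitAddCircle)) = 1 ↔ ∃ m : ℤ, (m : ℝ) = ∑ i, n i * a i := by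
  have h : mFourier n (fun i => (a i : UnitAddCircle)) =
      AddCircle.toCircle ((∑ i, n i * a i : ℝ) : UnitAddCircle) := by
    simp only [mFourier, ContinuousMap.coe_mk, fourier_coe_apply, AddCircle.toCircle_apply_mk,
      Circle.coe_exp, ← Complex.exp_sum]
    congr 1
    push_cast
    rw [Finset.mul_sum, Finset.sum_mul]
    exact Finset.sum_congr rfl fun i _ => by ring
  rw [h, Circle.coe_eq_one, ← AddCircle.toCircle_zero (T := (1 : ℝ)),
    (AddCircle.injective_toCircle one_ne_zero).eq_iff, AddCircle.coe_eq_zero_iff]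
  simp

/-- A continuous function is integrated in the same way by any two measures with the same Fourier
coefficients. -/
theorem integral_eq_of_forall_mFourier {μ ν : Measure (UnitAddTorus d)} [IsFiniteMeasure μ]
    [IsFiniteMeasure ν] (h : ∀ n : d → ℤ, ∫ x, mFourier n x ∂μ = ∫ x, mFourier n x ∂ν)
    (f : C(UnitAddTorus d, ℂ)) : ∫ x, f x ∂μ = ∫ x, f x ∂ν := by
  have hint (ρ : Measure (UnitAddTorus d)) [IsFiniteMeasure ρ] (g : C(UnitAddTorus d, ℂ)) :
      Integrable g ρ := g.continuous.integrable_of_hasCompactSupport (.of_compactSpace g)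
  have hcont (ρ : Measure (UnitAddTorus d)) [IsFiniteMeasure ρ] :
      Continuous fun g : C(UnitAddTorus d, ℂ) => ∫ x, g x ∂ρ := by
    refine ((L1.continuous_integral).comp (ContinuousMap.toLp 1 ρ ℂ).continuous).congr fun g => ?_
    exact (L1.integral_eq_integral _).trans (integral_congr_ae (ContinuousMap.coeFn_toLp ρ g))
  have hf : f ∈ closure (Submodule.span ℂ (Set.range (mFourier (d := d))) : Set _) := by
    rw [← Submodule.topologicalClosure_coe, span_mFourier_closure_eq_top]
    trivial
  refine closure_minimal (fun g hg => ?_) (isClosed_eq (hcont μ) (hcont ν)) hf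
  change ∫ x, g x ∂μ = ∫ x, g x ∂ν
  induction hg using Submodule.span_induction with
  | mem g hg => obtain ⟨n, rfl⟩ := hg; exact h n
  | zero => simp
  | add g₁ g₂ _ _ h₁ h₂ =>
    simp only [ContinuousMap.add_apply]
    rw [integral_add (hint μ g₁) (hint μ g₂), integral_add (hint ν g₁) (hint ν g₂), h₁, h₂]
  | smul c g _ hg => simp only [ContinuousMap.smul_apply, integral_smul, hg]

/-- Unique ergodicity of translations of the torus that are not annihilated by any character. -/
theorem eq_of_map_add_left_eq_self {μ ν : Measure (UnitAddTorus d)} [IsProbabilityMeasure μ]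
    [IsProbabilityMeasure ν] {a : UnitAddTorus d} (ha : ∀ n : d → ℤ, mFourier n a = 1 → n = 0)
    (hμ : μ.map (a + ·) = μ) (hν : ν.map (a + ·) = ν) : μ = ν := by
  have h (n : d → ℤ) : ∫ x, mFourier n x ∂μ = ∫ x, mFourier n x ∂ν := by
    by_cases hn : n = 0
    · simp [hn, mFourier_zero]
    · rw [integral_eq_zero_of_map_add_left hμ (mFourier_apply_add n a) (mt (ha n) hn),
        integral_eq_zero_of_map_add_left hν (mFourier_apply_add n a) (mt (ha n) hn)]
  refine ext_of_forall_integral_eq_of_IsFiniteMeasure fun f => ?_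
  have hf := integral_eq_of_forall_mFourier h ⟨fun x => (f x : ℂ), by fun_prop⟩
  simpa only [ContinuousMap.coe_mk, integral_complex_ofReal, Complex.ofReal_inj] using hf

/-- **Kronecker's theorem**: the multiples of a point of the torus which is not annihilated by any
nontrivial character are dense. -/
theorem dense_zmultiples {a : UnitAddTorus d} (ha : ∀ n : d → ℤ, mFourier n a = 1 → n = 0) :
    Dense (AddSubgroup.zmultiples a : Set (UnitAddTorus d)) := by
  set H := (AddSubgroup.zmultiples a).topologicalClosure
  have hHc : IsClosed (H : Set (UnitAddTorus d)) :=
    AddSubgroup.isClosed_topologicalClosure _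
  have : CompactSpace H := isCompact_iff_compactSpace.mp hHc.isCompact
  have haH : a ∈ H := AddSubgroup.le_topologicalClosure _ (AddSubgroup.mem_zmultiples a)
  set ρ : Measure H := Measure.addHaarMeasure ⊤
  have hρ : IsProbabilityMeasure ρ := ⟨Measure.addHaarMeasure_self (K₀ := ⊤)⟩
  have hmap : IsProbabilityMeasure (ρ.map Subtype.val) :=
    Measure.isProbabilityMeasure_map measurable_subtype_coe.aemeasurable
  set σ : Measure (UnitAddTorus d) := Measure.addHaarMeasure ⊤
  have hσ : IsProbabilityMeasure σ := ⟨Measure.addHaarMeasure_self (K₀ := ⊤)⟩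
  have key : ρ.map Subtype.val = σ := by
    refine eq_of_map_add_left_eq_self ha ?_ (map_add_left_eq_self σ a)
    rw [Measure.map_map (measurable_const_add a) measurable_subtype_coe]
    conv_rhs => rw [← map_add_left_eq_self ρ ⟨a, haH⟩]
    rw [Measure.map_map measurable_subtype_coe (measurable_const_add _)]
    rfl
  have hnull : σ (H : Set (UnitAddTorus d))ᶜ = 0 := by
    rw [← key, Measure.map_apply measurable_subtype_coe hHc.measurableSet.compl]
    convert measure_empty (μ := ρ)
    ext x
    simp
  have hempty := hHc.isOpen_compl.measure_eq_zero_iff σ |>.mp hnull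
  rw [dense_iff_closure_eq, ← AddSubgroup.topologicalClosure_coe]
  exact Set.compl_empty_iff.mp hempty

end UnitAddTorus


/-- Let `θ₁, …, θ_K` be reals, `1 ≤ j ≤ K`, with `1, θ₁, …, θ_j` linearly independent
over `ℚ`, and suppose every `θ_ℓ` with `ℓ > j` is a rational linear combination
`θ_ℓ = Σ_{i ≤ j} r_{ℓ,i} θ_i`. Let `V ⊆ ℝ^K` be the subspace cut out by these rational
relations, and `π : ℝ^K → 𝕋^K` the quotient map. Then the `ℤ`-orbit
`{π(x·θ) : x ∈ ℤ}` is contained in `π(V)` and is dense in `π(V)`. -/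
theorem orbit_dense_in_subspace (K : ℕ) (θ : Fin K → ℝ) (j : ℕ)
    (hj1 : 1 ≤ j) (hjK : j ≤ K)
    (hind : ∀ (q : ℚ) (cq : Fin j → ℚ),
      (q : ℝ) + ∑ i : Fin j, (cq i : ℝ) * θ (Fin.castLE hjK i) = 0 →
      q = 0 ∧ ∀ i, cq i = 0)
    (r : Fin K → Fin j → ℚ)
    (hr : ∀ ℓ : Fin K, j ≤ (ℓ : ℕ) →
      θ ℓ = ∑ i : Fin j, (r ℓ i : ℝ) * θ (Fin.castLE hjK i)) :
    (Set.range (fun t : ℤ => fun i : Fin K => (((t : ℝ) * θ i : ℝ) : AddCircle (1 : ℝ))) ⊆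
      (fun x : Fin K → ℝ => fun i : Fin K => ((x i : ℝ) : AddCircle (1 : ℝ))) ''
        {x : Fin K → ℝ | ∀ ℓ : Fin K, j ≤ (ℓ : ℕ) →
          x ℓ = ∑ i : Fin j, (r ℓ i : ℝ) * x (Fin.castLE hjK i)}) ∧
    ((fun x : Fin K → ℝ => fun i : Fin K => ((x i : ℝ) : AddCircle (1 : ℝ))) ''
        {x : Fin K → ℝ | ∀ ℓ : Fin K, j ≤ (ℓ : ℕ) →
          x ℓ = ∑ i : Fin j, (r ℓ i : ℝ) * x (Fin.castLE hjK i)} ⊆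
      closure (Set.range
        (fun t : ℤ => fun i : Fin K => (((t : ℝ) * θ i : ℝ) : AddCircle (1 : ℝ))))) := by
  have hlow (x : Fin K → ℝ) (ℓ : Fin K) (hℓ : (ℓ : ℕ) < j) :
      x ℓ = ∑ i : Fin j, ((if i = ⟨ℓ, hℓ⟩ then 1 else 0 : ℚ) : ℝ) * x (Fin.castLE hjK i) := by
    rw [Finset.sum_eq_single ⟨ℓ, hℓ⟩ (fun i _ hi => by simp [hi]) (by simp)]
    simp
  obtain ⟨R, hR⟩ : ∃ R : Fin K → Fin j → ℚ, ∀ x : Fin K → ℝ,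
      (∀ ℓ : Fin K, j ≤ (ℓ : ℕ) → x ℓ = ∑ i : Fin j, (r ℓ i : ℝ) * x (Fin.castLE hjK i)) →
      ∀ ℓ, x ℓ = ∑ i : Fin j, (R ℓ i : ℝ) * x (Fin.castLE hjK i) := by
    refine ⟨fun ℓ => if h : (ℓ : ℕ) < j then fun i => if i = ⟨ℓ, h⟩ then 1 else 0 else r ℓ,
      fun x hx ℓ => ?_⟩
    by_cases h : (ℓ : ℕ) < j
    · simpa only [dif_pos h] using hlow x ℓ h
    · simpa only [dif_neg h] using hx ℓ (not_lt.mp h)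
  obtain ⟨D, hD, N, hN⟩ : ∃ D : ℤ, D ≠ 0 ∧ ∃ N : Fin K → Fin j → ℤ,
      ∀ ℓ i, (N ℓ i : ℝ) = D * R ℓ i := by
    obtain ⟨⟨D, hD⟩, h⟩ := IsLocalization.exist_integer_multiples_of_finite
      (nonZeroDivisors ℤ) (fun p : Fin K × Fin j => R p.1 p.2)
    choose N hN using h
    refine ⟨D, nonZeroDivisors.ne_zero hD, fun ℓ i => N (ℓ, i), fun ℓ i => ?_⟩
    have := hN (ℓ, i)
    simp only [zsmul_eq_mul, eq_intCast] at this
    exact_mod_cast this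
  have hD' : (D : ℝ) ≠ 0 := by exact_mod_cast hD
  let φ : UnitAddTorus (Fin j) → UnitAddTorus (Fin K) := fun y ℓ => ∑ i, N ℓ i • y i
  have hφ : Continuous φ := by fun_prop
  have hφx (x : Fin K → ℝ) (hx : ∀ ℓ : Fin K, j ≤ (ℓ : ℕ) →
        x ℓ = ∑ i : Fin j, (r ℓ i : ℝ) * x (Fin.castLE hjK i)) :
      φ (fun i => ((x (Fin.castLE hjK i) / D : ℝ) : UnitAddCircle)) =
        fun ℓ => (x ℓ : UnitAddCircle) := by
    funext ℓ
    simp only [φ, ← AddCircle.coe_zsmul]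
    rw [hR x hx ℓ]
    refine (map_sum (QuotientAddGroup.mk' (AddSubgroup.zmultiples (1 : ℝ))) _ _).symm.trans ?_
    refine congrArg (QuotientAddGroup.mk' (AddSubgroup.zmultiples (1 : ℝ)))
      (Finset.sum_congr rfl fun i _ => ?_)
    rw [zsmul_eq_mul, hN]
    field_simp
  have hθ (t : ℤ) (ℓ : Fin K) (hℓ : j ≤ (ℓ : ℕ)) :
      t * θ ℓ = ∑ i : Fin j, (r ℓ i : ℝ) * (t * θ (Fin.castLE hjK i)) := by
    rw [hr ℓ hℓ, Finset.mul_sum]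
    exact Finset.sum_congr rfl fun i _ => by ring
  refine ⟨?_, ?_⟩
  · rintro _ ⟨t, rfl⟩
    exact ⟨fun i => t * θ i, hθ t, rfl⟩
  · rintro _ ⟨x, hx, rfl⟩
    let a : UnitAddTorus (Fin j) := fun i => ((θ (Fin.castLE hjK i) / D : ℝ) : UnitAddCircle)
    have ha (n : Fin j → ℤ) (hn : UnitAddTorus.mFourier n a = 1) : n = 0 := by
      obtain ⟨m, hm⟩ := (UnitAddTorus.mFourier_coe_eq_one_iff n _).mp hn
      have := (hind (-(m * D)) (fun i => n i) (by
        push_cast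
        rw [hm, Finset.sum_mul, neg_add_eq_zero]
        exact Finset.sum_congr rfl fun i _ => by field_simp)).2
      funext i
      exact_mod_cast this i
    refine closure_mono ?_ (image_closure_subset_closure_image hφ
      ⟨_, UnitAddTorus.dense_zmultiples ha _, hφx x hx⟩)
    rintro _ ⟨_, ⟨t, rfl⟩, rfl⟩
    refine ⟨t, ?_⟩
    refine (hφx (fun i => t * θ i) (hθ t)).symm.trans (congrArg φ ?_)
    funext i
    simp only [a, Pi.smul_apply, ← AddCircle.coe_zsmul, zsmul_eq_mul, mul_div_assoc]
end

section
/- Let p₁ and p₂ be distinct primes, let q ≥ 2 be an integer, and let m₁, m₂, k₁, k₂ be positive integers. Then there is at most one pair (n, j), with n a nonnegative integer and j an integer, satisfying both k₁·q^n − j·p₁^{m₁} = 1 and k₂·q^n − j·p₂^{m₂} = 1 (equivalently, k₁/p₁^{m₁} − j/q^n = 1/(p₁^{m₁}·q^n) and k₂/p₂^{m₂} − j/q^n = 1/(p₂^{m₂}·q^n)). -/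
/-- Let `p₁ ≠ p₂` be primes, `q ≥ 2` an integer, and `m₁, m₂, k₁, k₂` positive integers.
Then there is at most one pair `(n, j)` with `n ∈ ℕ`, `j ∈ ℤ`, satisfying both
`k₁·q^n − j·p₁^{m₁} = 1` and `k₂·q^n − j·p₂^{m₂} = 1`. -/
theorem at_most_one_solution (p₁ p₂ : ℕ) (hp₁ : p₁.Prime) (hp₂ : p₂.Prime)
    (hne : p₁ ≠ p₂) (q : ℕ) (hq : 2 ≤ q) (m₁ m₂ k₁ k₂ : ℕ)
    (hm₁ : 0 < m₁) (hm₂ : 0 < m₂) (hk₁ : 0 < k₁) (hk₂ : 0 < k₂) :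
    ∀ (n n' : ℕ) (j j' : ℤ),
      (k₁ : ℤ) * (q : ℤ) ^ n - j * (p₁ : ℤ) ^ m₁ = 1 →
      (k₂ : ℤ) * (q : ℤ) ^ n - j * (p₂ : ℤ) ^ m₂ = 1 →
      (k₁ : ℤ) * (q : ℤ) ^ n' - j' * (p₁ : ℤ) ^ m₁ = 1 →
      (k₂ : ℤ) * (q : ℤ) ^ n' - j' * (p₂ : ℤ) ^ m₂ = 1 →
      n = n' ∧ j = j' := by
  intro n n' j j' h₁ h₂ h₁' h₂'
  have hpow : (p₁ : ℤ) ^ m₁ ≠ (p₂ : ℤ) ^ m₂ := by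
    intro h
    have h' : p₁ ^ m₁ = p₂ ^ m₂ := by exact_mod_cast h
    have hdvd : p₁ ∣ p₂ ^ m₂ := h' ▸ dvd_pow_self p₁ hm₁.ne'
    exact hne ((Nat.prime_dvd_prime_iff_eq hp₁ hp₂).mp (hp₁.dvd_of_dvd_pow hdvd))
  have hn : ((k₁ : ℤ) * (p₂ : ℤ) ^ m₂ - k₂ * (p₁ : ℤ) ^ m₁) * (q : ℤ) ^ n =
      (p₂ : ℤ) ^ m₂ - (p₁ : ℤ) ^ m₁ := by
    linear_combination (p₂ : ℤ) ^ m₂ * h₁ - (p₁ : ℤ) ^ m₁ * h₂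
  have hn' : ((k₁ : ℤ) * (p₂ : ℤ) ^ m₂ - k₂ * (p₁ : ℤ) ^ m₁) * (q : ℤ) ^ n' =
      (p₂ : ℤ) ^ m₂ - (p₁ : ℤ) ^ m₁ := by
    linear_combination (p₂ : ℤ) ^ m₂ * h₁' - (p₁ : ℤ) ^ m₁ * h₂'
  have hcoeff : (k₁ : ℤ) * (p₂ : ℤ) ^ m₂ - k₂ * (p₁ : ℤ) ^ m₁ ≠ 0 := by
    intro h
    rw [h, zero_mul] at hn
    exact hpow (sub_eq_zero.mp hn.symm).symm
  have hq_pow : (q : ℤ) ^ n = (q : ℤ) ^ n' := mul_left_cancel₀ hcoeff (hn.trans hn'.symm)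
  refine ⟨Nat.pow_right_injective hq (by exact_mod_cast hq_pow), ?_⟩
  have hp_pow : (p₁ : ℤ) ^ m₁ ≠ 0 := pow_ne_zero _ (by exact_mod_cast hp₁.ne_zero)
  apply mul_right_cancel₀ hp_pow
  linear_combination h₁' - h₁ + (k₁ : ℤ) * hq_pow
end
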